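/- arXiv:1908.02915 — 2 statements merged into one kernel-verified Lean document; each statement's English description precedes it below -/
import Mathlib

section
/- Let n ≥ 1 and let Γ be a nontrivial finite abelian group acting faithfully on V = ℂⁿ by ℂ-linear automorphisms, such that for every γ ∈ Γ with γ ≠ 1 the fixed-point subspace V^γ = {v ∈ V : γ·v = v} has complex codimension at least 2 in V (i.e., no non-identity element of Γ acts as a pseudoreflection). Then no open neighborhood of the image [0] of the origin in the orbit space V/Γ is homeomorphic to ℝ^{2n}; in particular V/Γ is not a topological manifold at [0]. -/
/-- The orbit equivalence relation of a group action given by `φ : G →* Function.End X`;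
the quotient `Quotient (actionSetoid φ)` is the orbit space `X/G` (with the quotient
topology when `X` is a topological space). -/
def actionSetoid {G X : Type*} [Group G] (φ : G →* Function.End X) : Setoid X where
  r v w := ∃ g : G, φ g v = w
  iseqv := by
    constructor
    · intro v
      exact ⟨1, by rw [map_one]; rfl⟩
    · rintro v w ⟨g, rfl⟩
      refine ⟨g⁻¹, ?_⟩
      have h : φ g⁻¹ * φ g = 1 := by rw [← map_mul, inv_mul_cancel, map_one]
      calc φ g⁻¹ (φ g v) = (φ g⁻¹ * φ g) v := rfl
      _ = v := by rw [h]; rfl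
    · rintro u v w ⟨g, rfl⟩ ⟨g', rfl⟩
      refine ⟨g' * g, ?_⟩
      calc φ (g' * g) u = (φ g' * φ g) u := by rw [map_mul]
      _ = φ g' (φ g u) := rfl

/-- The action on `V` underlying a homomorphism into the group of ℂ-linear automorphisms. -/
def endHomOfRep {Γ V : Type*} [Group Γ] [AddCommGroup V] [Module ℂ V]
    (ρ : Γ →* (V ≃ₗ[ℂ] V)) : Γ →* Function.End V where
  toFun γ := ⇑(ρ γ)
  map_one' := by
    funext v
    show ρ 1 v = v
    rw [map_one]; rfl
  map_mul' := by
    intro a b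
    funext v
    show ρ (a * b) v = (ρ a) ((ρ b) v)
    rw [map_mul]; rfl

/-- The alternating-sum coboundary of a cochain on tuples. -/
def tupleCoboundary {X A : Type*} [AddCommGroup A] {q : ℕ} (φ : (Fin (q + 1) → X) → A)
    (p : Fin (q + 2) → X) : A :=
  ∑ k : Fin (q + 2), (-1 : ℤ) ^ (k : ℕ) • φ (fun l => p (k.succAbove l))

/-- The cup product `δs₀ ∪ ⋯ ∪ δs_{r-1} ∪ h` of coboundaries of integer functions with a
`1`-cochain. -/
def cupDiffs {X A : Type*} [AddCommGroup A] (h : X → X → A) :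
    (r : ℕ) → (Fin r → X → ℤ) → (Fin (r + 2) → X) → A
  | 0, _, p => h (p 0) (p 1)
  | r + 1, s, p => (s 0 (p 1) - s 0 (p 0)) • cupDiffs h r (fun j => s j.succ) (fun k => p k.succ)

theorem cupDiffs_eq {X A : Type*} [AddCommGroup A] (h : X → X → A) (r : ℕ)
    (s : Fin r → X → ℤ) (p : Fin (r + 2) → X) :
    cupDiffs h r s p =
      (∏ j : Fin r, (s j (p j.succ.castSucc) - s j (p j.castSucc.castSucc))) •
        h (p (Fin.last r).castSucc) (p (Fin.last (r + 1))) := by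
  induction r with
  | zero => simp [cupDiffs]
  | succ r ih =>
    rw [cupDiffs, ih, Fin.prod_univ_succ, mul_smul]
    rfl

theorem tupleCoboundary_cupDiffs_succ {X A : Type*} [AddCommGroup A] (h : X → X → A) (r : ℕ)
    (s : Fin (r + 1) → X → ℤ) (p : Fin (r + 1 + 3) → X) :
    tupleCoboundary (cupDiffs h (r + 1) s) p =
      -((s 0 (p 1) - s 0 (p 0)) •
        tupleCoboundary (cupDiffs h r fun j => s j.succ) (fun k => p k.succ)) := by
  unfold tupleCoboundary
  rw [Fin.sum_univ_succ, Fin.sum_univ_succ, Fin.sum_univ_succ (n := r + 2)]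
  simp only [cupDiffs]
  have e1 : ∀ i : Fin (r + 2), (i.succ.succ : Fin (r + 1 + 3)).succAbove (1 : Fin (r + 3)) = 1 := by
    intro i
    rw [← Fin.succ_zero_eq_one, Fin.succ_succAbove_succ, Fin.succ_succAbove_zero]
    rfl
  have e2 : ((0 : Fin (r + 3)).succ).succAbove (1 : Fin (r + 3)) = 2 := by
    rw [← Fin.succ_zero_eq_one, Fin.succ_succAbove_succ]; rfl
  have e3 : (0 : Fin (r + 1 + 3)).succAbove (1 : Fin (r + 3)) = 2 := by rfl
  have e4 : (0 : Fin (r + 1 + 3)).succAbove (0 : Fin (r + 3)) = 1 := by rfl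
  simp only [e1, e2, e3, e4, Fin.succ_succAbove_succ, Fin.succ_succAbove_zero,
    Fin.succAbove_zero, Fin.val_zero, Fin.val_succ, pow_zero, pow_succ, smul_add, Finset.smul_sum]
  rw [neg_add, ← Finset.sum_neg_distrib, ← add_assoc]
  congr 1
  · module
  · refine Finset.sum_congr rfl fun i _ => ?_
    module

theorem tupleCoboundary_cupDiffs_eq_zero {X A : Type*} [AddCommGroup A] (h : X → X → A) (r : ℕ)
    (s : Fin r → X → ℤ) (p : Fin (r + 3) → X)
    (hp : (∀ j : Fin r, s j (p j.castSucc.castSucc.castSucc) ≠ s j (p j.succ.castSucc.castSucc)) →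
      h (p (Fin.last r).castSucc.castSucc) (p (Fin.last (r + 1)).castSucc) +
        h (p (Fin.last (r + 1)).castSucc) (p (Fin.last (r + 2))) =
      h (p (Fin.last r).castSucc.castSucc) (p (Fin.last (r + 2)))) :
    tupleCoboundary (cupDiffs h r s) p = 0 := by
  induction r with
  | zero =>
    have := hp (fun j => j.elim0)
    have h1 : h (p 0) (p 1) + h (p 1) (p 2) = h (p 0) (p 2) := this
    refine (Fin.sum_univ_three _).trans ?_
    change (-1 : ℤ) ^ 0 • h (p 1) (p 2) + (-1 : ℤ) ^ 1 • h (p 0) (p 2) +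
      (-1 : ℤ) ^ 2 • h (p 0) (p 1) = 0
    rw [← h1]
    module
  | succ r ih =>
    rw [tupleCoboundary_cupDiffs_succ]
    by_cases h0 : s 0 (p 0) = s 0 (p 1)
    · simp [h0]
    · rw [ih, smul_zero, neg_zero]
      intro hj
      refine hp (Fin.cases h0 hj)

/-- The `k`-th vertex of the simplex of the Freudenthal triangulation of the cube with lowest
corner `v` which adds the basis vectors in the order given by `π`. -/
def staircase {N : ℕ} (π : Equiv.Perm (Fin N)) (v : Fin N → ℕ) (k : Fin (N + 1)) : Fin N → ℕ :=
  fun i => v i + if (π.symm i).castSucc < k then 1 else 0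

theorem sum_sign_tupleCoboundary_staircase {A : Type*} [AddCommGroup A] {n : ℕ}
    (φ : (Fin (n + 1) → Fin (n + 1) → ℕ) → A) (v : Fin (n + 1) → ℕ) :
    ∑ π : Equiv.Perm (Fin (n + 1)), (π.sign : ℤ) • tupleCoboundary φ (staircase π v) =
      (-1 : ℤ) ^ n • ∑ π : Equiv.Perm (Fin (n + 1)), (π.sign : ℤ) •
        (φ (fun l => staircase π (v + Pi.single (π (Fin.last n)) 1) l.castSucc) -
          φ (fun l => staircase π v l.castSucc)) := by
  simp only [tupleCoboundary, Finset.smul_sum]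
  rw [Finset.sum_comm, Fin.sum_univ_succ, Fin.sum_univ_castSucc]
  have hmid : ∑ j : Fin n, ∑ π : Equiv.Perm (Fin (n + 1)), (π.sign : ℤ) •
      (-1 : ℤ) ^ ((j.castSucc.succ : Fin (n + 2)) : ℕ) •
        φ (fun l => staircase π v (j.castSucc.succ.succAbove l)) = 0 := by
    refine Finset.sum_eq_zero fun j _ => ?_
    have hne : j.castSucc ≠ j.succ := (Fin.castSucc_lt_succ).ne
    refine Finset.sum_involution (fun π _ => π * Equiv.swap j.castSucc j.succ) ?_ ?_ ?_ ?_
    · intro π _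
      have : (fun l => staircase (π * Equiv.swap j.castSucc j.succ) v
          (j.castSucc.succ.succAbove l)) =
          fun l => staircase π v (j.castSucc.succ.succAbove l) := by
        funext l i
        simp only [staircase]
        congr 1
        have hl : (j.castSucc.succ.succAbove l) ≠ j.castSucc.succ := Fin.succAbove_ne _ _
        generalize j.castSucc.succ.succAbove l = l' at hl
        have : (π * Equiv.swap j.castSucc j.succ).symm i =
            Equiv.swap j.castSucc j.succ (π.symm i) := by
          rw [Equiv.symm_apply_eq]; simp
        rw [this]
        generalize π.symm i = a
        congr 1
        rw [eq_iff_iff]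
        rcases eq_or_ne a j.castSucc with rfl | h1
        · rw [Equiv.swap_apply_left]
          simp only [Fin.lt_def, Fin.ext_iff, ne_eq, Fin.val_castSucc, Fin.val_succ] at *
          omega
        rcases eq_or_ne a j.succ with rfl | h2
        · rw [Equiv.swap_apply_right]
          simp only [Fin.lt_def, Fin.ext_iff, ne_eq, Fin.val_castSucc, Fin.val_succ] at *
          omega
        · rw [Equiv.swap_apply_of_ne_of_ne h1 h2]
      rw [this, Equiv.Perm.sign_mul, Equiv.Perm.sign_swap hne]
      simp
    · intro π _ _ h
      have := congrArg (fun τ => π⁻¹ * τ) h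
      simp only [inv_mul_cancel_left, inv_mul_cancel] at this
      exact hne (Equiv.swap_eq_one_iff.1 this)
    · intro π _; exact Finset.mem_univ _
    · intro π _
      simp [mul_assoc]
  rw [hmid, zero_add]
  rw [← Equiv.sum_comp (Equiv.mulRight (finRotate (n + 1))⁻¹), ← Finset.sum_add_distrib]
  refine Finset.sum_congr rfl fun π _ => ?_
  have h0 : (fun l => staircase (Equiv.mulRight (finRotate (n + 1))⁻¹ π) v
      ((0 : Fin (n + 2)).succAbove l)) =
      fun l => staircase π (v + Pi.single (π (Fin.last n)) 1) l.castSucc := by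
    funext l i
    simp only [staircase, Fin.succAbove_zero, Pi.add_apply, add_assoc]
    congr 1
    have h1 : (Equiv.mulRight (finRotate (n + 1))⁻¹ π).symm i = finRotate (n + 1) (π.symm i) := by
      rw [Equiv.symm_apply_eq]; simp
    rw [h1]
    obtain ⟨a, rfl⟩ := π.surjective i
    rw [Equiv.symm_apply_apply]
    rcases eq_or_ne a (Fin.last n) with rfl | ha
    · rw [finRotate_last]
      have : ¬ (Fin.last n).castSucc < l.castSucc := by
        simp [Fin.lt_def]; omega
      simp [this]
    · have hv := coe_finRotate_of_ne_last ha
      rw [Pi.single_eq_of_ne (by simpa using ha), zero_add]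
      congr 1
      simp only [Fin.lt_def, Fin.val_castSucc, Fin.val_succ, hv]
      simp
  have h1 : (fun l => staircase π v ((Fin.last n).succ.succAbove l)) =
      fun l => staircase π v l.castSucc := by
    funext l
    rw [Fin.succ_last, Fin.succAbove_last]
  rw [h0, h1]
  simp only [Equiv.coe_mulRight, Equiv.Perm.sign_mul, Equiv.Perm.sign_inv, sign_finRotate]
  simp [pow_succ, smul_smul]
  rw [mul_comm, smul_sub, sub_eq_add_neg]

theorem sum_box_add_single_sub {A : Type*} [AddCommGroup A] {n : ℕ} (M : ℕ) (i : Fin (n + 1))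
    (G : (Fin (n + 1) → ℕ) → A) :
    ∑ v : Fin (n + 1) → Fin M, (G ((fun k => (v k : ℕ)) + Pi.single i 1) - G fun k => (v k : ℕ)) =
      ∑ w : Fin n → Fin M, (G (i.insertNth M fun k => (w k : ℕ)) -
        G (i.insertNth 0 fun k => (w k : ℕ))) := by
  rw [← Equiv.sum_comp (Fin.insertNthEquiv (fun _ => Fin M) i), Fintype.sum_prod_type_right]
  refine Finset.sum_congr rfl fun w _ => ?_
  have key : ∀ a : Fin M, (fun k => ((Fin.insertNthEquiv (fun _ => Fin M) i (a, w)) k : ℕ)) =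
      i.insertNth (a : ℕ) fun k => (w k : ℕ) := by
    intro a
    funext k
    refine Fin.succAboveCases i ?_ (fun k => ?_) k <;> simp
  have key2 : ∀ a : ℕ, (i.insertNth a fun k => (w k : ℕ)) + Pi.single i 1 =
      (i.insertNth (a + 1) fun k => (w k : ℕ) : Fin (n + 1) → ℕ) := by
    intro a
    funext k
    refine Fin.succAboveCases i ?_ (fun k => ?_) k <;> simp
  simp only [key, key2]
  rw [Fin.sum_univ_eq_sum_range
    (fun a => G (i.insertNth (a + 1) fun k => (w k : ℕ)) - G (i.insertNth a fun k => (w k : ℕ))),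
    Finset.sum_range_sub fun a => G (i.insertNth a fun k => (w k : ℕ))]

/-- The value of `δs₀ ∪ ⋯ ∪ δs_{r-1} ∪ h` on a boundary simplex of the grid. -/
theorem cupDiffs_staircase_of_mem_face {A : Type*} [AddCommGroup A] {r m : ℕ}
    {s : Fin r → (Fin (r + 2) → ℕ) → ℤ} {h : (Fin (r + 2) → ℕ) → (Fin (r + 2) → ℕ) → A} {h₀ : A}
    (hs : ∀ x j, (∀ i, x i ≤ 2 * m) → (∃ i, x i = 0 ∨ x i = 2 * m) →
      s j x = if m < x j.castSucc.castSucc then 1 else 0)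
    (ha : ∀ x, (∀ i, x i ≤ 2 * m) → (∀ j : Fin r, x j.castSucc.castSucc = m + 1) →
      x (Fin.last _) = 0 → x (Fin.last r).castSucc < 2 * m →
      h x (x + Pi.single (Fin.last r).castSucc 1) = if x (Fin.last r).castSucc = m then h₀ else 0)
    (hb : ∀ x, (∀ i, x i ≤ 2 * m) → (∀ j : Fin r, x j.castSucc.castSucc = m + 1) →
      x (Fin.last _) = 2 * m → x (Fin.last r).castSucc < 2 * m →
      h x (x + Pi.single (Fin.last r).castSucc 1) = 0)
    (hc : ∀ x, (∀ i, x i ≤ 2 * m) → (∀ j : Fin r, x j.castSucc.castSucc = m + 1) →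
      (x (Fin.last r).castSucc = 0 ∨ x (Fin.last r).castSucc = 2 * m) →
      x (Fin.last _) < 2 * m → h x (x + Pi.single (Fin.last _) 1) = 0)
    (π : Equiv.Perm (Fin (r + 2))) (v : Fin (r + 2) → ℕ)
    (hv : v (π (Fin.last _)) = 0 ∨ v (π (Fin.last _)) = 2 * m)
    (hv' : ∀ i, i ≠ π (Fin.last _) → v i < 2 * m) :
    cupDiffs h r s (fun l => staircase π v l.castSucc) =
      if π = 1 ∧ v (Fin.last _) = 0 ∧ ∀ j : Fin (r + 1), v j.castSucc = m then h₀ else 0 := by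
  have hlast : ∀ l : Fin (r + 2), ¬ (Fin.last (r + 1)).castSucc < l.castSucc := by
    intro l; simp only [Fin.lt_def, Fin.val_castSucc, Fin.val_last]; omega
  have hface : ∀ l : Fin (r + 2), staircase π v l.castSucc (π (Fin.last _)) =
      v (π (Fin.last _)) := by
    intro l; simp [staircase, hlast]
  have hle : ∀ (l : Fin (r + 2)) i, staircase π v l.castSucc i ≤ 2 * m := by
    intro l i
    by_cases hi : i = π (Fin.last _)
    · rw [hi, hface]; omega
    · have := hv' i hi
      simp only [staircase]; split_ifs <;> omega
  have hS : ∀ (l : Fin (r + 2)) (j : Fin r), s j (staircase π v l.castSucc) =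
      if m < staircase π v l.castSucc j.castSucc.castSucc then 1 else 0 := fun l j =>
    hs _ j (hle l) ⟨_, by rw [hface]; exact hv⟩
  rw [cupDiffs_eq]
  by_cases hgood : ∀ j : Fin r, π.symm j.castSucc.castSucc = j.castSucc.castSucc ∧
      v j.castSucc.castSucc = m
  swap
  · push Not at hgood
    obtain ⟨j, hj⟩ := hgood
    rw [Finset.prod_eq_zero (Finset.mem_univ j), zero_smul, if_neg]
    · rintro ⟨rfl, -, h3⟩
      exact hj rfl (h3 _)
    · rw [hS, hS, sub_eq_zero]
      congr 1
      rw [eq_iff_iff]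
      simp only [staircase]
      have hne : (π.symm j.castSucc.castSucc : ℕ) = j → v j.castSucc.castSucc ≠ m := fun h =>
        hj (Fin.ext h)
      simp only [Fin.lt_def, Fin.val_castSucc, Fin.val_succ]
      split_ifs <;> omega
  have hprod : ∏ j : Fin r, (s j (staircase π v j.succ.castSucc.castSucc) -
      s j (staircase π v j.castSucc.castSucc.castSucc)) = 1 := by
    refine Finset.prod_eq_one fun j _ => ?_
    rw [hS, hS]
    simp only [staircase, (hgood j).1, (hgood j).2]
    simp [Fin.lt_def]
  rw [hprod, one_smul]
  set x := staircase π v (Fin.last r).castSucc.castSucc with hx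
  have hstep : staircase π v (Fin.last (r + 1)).castSucc =
      x + Pi.single (π (Fin.last r).castSucc) 1 := by
    funext i
    obtain ⟨a, rfl⟩ := π.surjective i
    simp only [hx, staircase, Pi.add_apply, Equiv.symm_apply_apply, add_assoc]
    congr 1
    rcases eq_or_ne a (Fin.last r).castSucc with rfl | ha
    · simp [Fin.lt_def]
    · rw [Pi.single_eq_of_ne (by simpa using ha), add_zero]
      congr 1
      rw [eq_iff_iff]
      have : (a : ℕ) ≠ r := fun h => ha (Fin.ext h)
      simp only [Fin.lt_def, Fin.val_castSucc, Fin.val_last]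
      omega
  have hxj : ∀ j : Fin r, x j.castSucc.castSucc = m + 1 := by
    intro j
    simp only [hx, staircase, (hgood j).1, (hgood j).2]
    simp [Fin.lt_def]
  have hfix : ∀ j : Fin r, π j.castSucc.castSucc = j.castSucc.castSucc := fun j =>
    ((Equiv.symm_apply_eq _).1 (hgood j).1).symm
  have hrange : ∀ a : Fin (r + 2), (∀ j : Fin r, a ≠ j.castSucc.castSucc) →
      π a = (Fin.last r).castSucc ∨ π a = Fin.last (r + 1) := by
    intro a h
    by_contra! hcon
    have h1 : (π a : ℕ) ≠ r := fun h => hcon.1 (Fin.ext h)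
    have h2 : (π a : ℕ) ≠ r + 1 := fun h => hcon.2 (Fin.ext h)
    have h3 : (π a : ℕ) < r := by omega
    refine h ⟨π a, h3⟩ (π.injective ?_)
    rw [hfix]
    exact Fin.ext rfl
  have hr1 := hrange (Fin.last r).castSucc (fun j h => by
    have := congrArg Fin.val h; simp at this; omega)
  have hr2 := hrange (Fin.last (r + 1)) (fun j h => by
    have := congrArg Fin.val h; simp at this; omega)
  have hr3 : π (Fin.last r).castSucc ≠ π (Fin.last (r + 1)) := fun h => by
    have := congrArg Fin.val (π.injective h); simp at this
  have hxlt : ∀ i, π.symm i = (Fin.last r).castSucc → x i < 2 * m := by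
    intro i hi
    have : i ≠ π (Fin.last _) := fun h => hr3 (by rw [← h, ← hi, Equiv.apply_symm_apply])
    simp only [hx, staircase, hi, lt_irrefl, if_false]
    exact hv' i this
  rw [hstep]
  have hxf := hface (Fin.last r).castSucc
  rw [← hx] at hxf
  rcases hr1 with h1 | h1
  · have h2 : π (Fin.last (r + 1)) = Fin.last (r + 1) :=
      hr2.resolve_left fun h => hr3 (h1.trans h.symm)
    have hπ : π = 1 := by
      ext a
      rw [Equiv.Perm.one_apply]
      refine Fin.lastCases ?_ (fun a => ?_) a
      · rw [h2]
      refine Fin.lastCases ?_ (fun a => ?_) a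
      · rw [h1]
      · rw [hfix]
    have hx2 := hxlt _ ((Equiv.symm_apply_eq _).2 h1.symm)
    have hxv : x (Fin.last r).castSucc = v (Fin.last r).castSucc := by
      simp [hx, staircase, (Equiv.symm_apply_eq π).2 h1.symm]
    rw [h2] at hxf hv
    rw [h1]
    rcases hv with hv | hv
    · rw [ha x (hle _) hxj (hxf.trans hv) hx2, hxv]
      congr 1
      rw [eq_iff_iff]
      refine ⟨fun h => ⟨hπ, hv, fun j => ?_⟩, fun h => h.2.2 _⟩
      exact Fin.lastCases h (fun j => (hgood j).2) j
    · rw [hb x (hle _) hxj (hxf.trans hv) hx2, if_neg]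
      rintro ⟨-, h0, hm⟩
      have := hm (Fin.last r)
      omega
  · have h2 : π (Fin.last (r + 1)) = (Fin.last r).castSucc :=
      hr2.resolve_right (fun h => hr3 (h1.trans h.symm))
    have hx2 := hxlt _ ((Equiv.symm_apply_eq _).2 h1.symm)
    rw [h2] at hxf hv
    rw [h1, hc x (hle _) hxj (by rw [hxf]; exact hv) hx2, if_neg]
    rintro ⟨rfl, -⟩
    have := congrArg Fin.val h1
    simp at this

/-- A combinatorial Stokes theorem: on a cubical grid of dimension `r + 2`, if the cup product of
the `δsⱼ` with `h` is closed, then the total value of `h` around the boundary of the middle square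
vanishes. -/
theorem grid_boundary_value_eq_zero {A : Type*} [AddCommGroup A] {r m : ℕ} (hm : 0 < m)
    {s : Fin r → (Fin (r + 2) → ℕ) → ℤ} {h : (Fin (r + 2) → ℕ) → (Fin (r + 2) → ℕ) → A} {h₀ : A}
    (hcocycle : ∀ p : Fin (r + 3) → Fin (r + 2) → ℕ,
      (∃ v : Fin (r + 2) → ℕ, ∀ i, v i < 2 * m ∧ ∀ k, v i ≤ p k i ∧ p k i ≤ v i + 1) →
      (∀ j : Fin r, s j (p j.castSucc.castSucc.castSucc) ≠ s j (p j.succ.castSucc.castSucc)) →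
      h (p (Fin.last r).castSucc.castSucc) (p (Fin.last (r + 1)).castSucc) +
        h (p (Fin.last (r + 1)).castSucc) (p (Fin.last (r + 2))) =
      h (p (Fin.last r).castSucc.castSucc) (p (Fin.last (r + 2))))
    (hs : ∀ x j, (∀ i, x i ≤ 2 * m) → (∃ i, x i = 0 ∨ x i = 2 * m) →
      s j x = if m < x j.castSucc.castSucc then 1 else 0)
    (ha : ∀ x, (∀ i, x i ≤ 2 * m) → (∀ j : Fin r, x j.castSucc.castSucc = m + 1) →
      x (Fin.last _) = 0 → x (Fin.last r).castSucc < 2 * m →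
      h x (x + Pi.single (Fin.last r).castSucc 1) = if x (Fin.last r).castSucc = m then h₀ else 0)
    (hb : ∀ x, (∀ i, x i ≤ 2 * m) → (∀ j : Fin r, x j.castSucc.castSucc = m + 1) →
      x (Fin.last _) = 2 * m → x (Fin.last r).castSucc < 2 * m →
      h x (x + Pi.single (Fin.last r).castSucc 1) = 0)
    (hc : ∀ x, (∀ i, x i ≤ 2 * m) → (∀ j : Fin r, x j.castSucc.castSucc = m + 1) →
      (x (Fin.last r).castSucc = 0 ∨ x (Fin.last r).castSucc = 2 * m) →
      x (Fin.last _) < 2 * m → h x (x + Pi.single (Fin.last _) 1) = 0) :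
    h₀ = 0 := by
  have hcob : ∀ v : Fin (r + 2) → Fin (2 * m), ∀ π : Equiv.Perm (Fin (r + 2)),
      tupleCoboundary (cupDiffs h r s) (staircase π fun k => (v k : ℕ)) = 0 := by
    intro v π
    refine tupleCoboundary_cupDiffs_eq_zero h r s _ (hcocycle _ ⟨fun k => (v k : ℕ), fun i => ?_⟩)
    refine ⟨(v i).2, fun k => ?_⟩
    simp only [staircase]
    split_ifs <;> omega
  have hsum : ∑ v : Fin (r + 2) → Fin (2 * m), ∑ π : Equiv.Perm (Fin (r + 2)), (π.sign : ℤ) •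
        (cupDiffs h r s (fun l => staircase π
            ((fun k => (v k : ℕ)) + Pi.single (π (Fin.last (r + 1))) 1) l.castSucc) -
          cupDiffs h r s (fun l => staircase π (fun k => (v k : ℕ)) l.castSucc)) = 0 := by
    refine Finset.sum_eq_zero fun v _ => ?_
    have := sum_sign_tupleCoboundary_staircase (cupDiffs h r s) fun k => (v k : ℕ)
    simp only [hcob, smul_zero, Finset.sum_const_zero] at this
    have h2 := congrArg (fun a => (-1 : ℤ) ^ (r + 1) • a) this
    simp only [smul_zero, smul_smul, ← pow_add, ← two_mul, pow_mul, neg_one_sq, one_pow,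
      one_smul] at h2
    exact h2.symm
  rw [Finset.sum_comm] at hsum
  simp only [← Finset.smul_sum] at hsum
  have hval : ∀ π : Equiv.Perm (Fin (r + 2)), ∀ w : Fin (r + 1) → Fin (2 * m), ∀ a,
      (a = 0 ∨ a = 2 * m) → cupDiffs h r s (fun l => staircase π
        ((π (Fin.last (r + 1))).insertNth a fun k => (w k : ℕ)) l.castSucc) =
      if π = 1 ∧ a = 0 ∧ w = fun _ => ⟨m, by omega⟩ then h₀ else 0 := by
    intro π w a haa
    rw [cupDiffs_staircase_of_mem_face hs ha hb hc π _ (by simpa using haa)]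
    · congr 1
      rw [eq_iff_iff]
      refine and_congr_right fun hπ => ?_
      subst hπ
      simp only [Equiv.Perm.one_apply, Fin.insertNth_last', Fin.snoc_last, Fin.snoc_castSucc,
        funext_iff, Fin.ext_iff]
    · intro i hi
      obtain ⟨k, rfl⟩ := Fin.exists_succAbove_eq hi
      simp
  have hface : ∀ π : Equiv.Perm (Fin (r + 2)),
      ∑ v : Fin (r + 2) → Fin (2 * m),
        (cupDiffs h r s (fun l => staircase π
            ((fun k => (v k : ℕ)) + Pi.single (π (Fin.last (r + 1))) 1) l.castSucc) -
          cupDiffs h r s (fun l => staircase π (fun k => (v k : ℕ)) l.castSucc)) =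
      if π = 1 then -h₀ else 0 := by
    intro π
    rw [sum_box_add_single_sub (2 * m) (π (Fin.last (r + 1)))
      (fun v => cupDiffs h r s (fun l => staircase π v l.castSucc))]
    have hm' : ¬ m = 0 := hm.ne'
    simp only [hval π _ _ (Or.inl rfl), hval π _ _ (Or.inr rfl)]
    by_cases hπ : π = 1
    · simp [hπ, hm']
    · simp [hπ]
  simp only [hface] at hsum
  simpa using hsum

/-- A continuous map into a space of larger dimension can be perturbed near its zeros so as to
become nowhere zero. -/
theorem Continuous.exists_ne_zero_of_finrank_lt {E F : Type*} [NormedAddCommGroup E]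
    [NormedSpace ℝ E] [FiniteDimensional ℝ E] [NormedAddCommGroup F] [NormedSpace ℝ F]
    [FiniteDimensional ℝ F] (hlt : Module.finrank ℝ E < Module.finrank ℝ F) {f : E → F}
    (hf : Continuous f) {δ : ℝ} (hδ : 0 < δ) :
    ∃ g : E → F, Continuous g ∧ (∀ x, g x ≠ 0) ∧ (∀ x, δ ≤ ‖f x‖ → g x = f x) ∧
      ∀ x, ‖g x - f x‖ < δ := by
  obtain ⟨P, hP, hPf, -⟩ := hf.exists_contDiff_approx (n := 1) (ε := fun _ => δ / 4)
    continuous_const (fun _ => by positivity)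
  obtain ⟨w, hw, hwP⟩ := (hP.dense_compl_range_of_finrank_lt_finrank hlt).exists_dist_lt 0
    (show 0 < δ / 4 by positivity)
  rw [dist_zero_left] at hwP
  set c : E → ℝ := fun x => max 0 (min 1 (2 - 2 * ‖f x‖ / δ)) with hc
  have hc0 : ∀ x, 0 ≤ c x := fun x => le_max_left _ _
  have hc1 : ∀ x, c x ≤ 1 := fun x => max_le zero_le_one (min_le_left _ _)
  have hd : ∀ x, ‖P x - w - f x‖ < δ / 2 := by
    intro x
    have h1 := hPf x
    rw [dist_eq_norm] at h1
    calc ‖P x - w - f x‖ = ‖(P x - f x) - w‖ := by congr 1; abel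
      _ ≤ ‖P x - f x‖ + ‖w‖ := norm_sub_le _ _
      _ < δ / 2 := by linarith
  have hcd : ∀ x, ‖c x • (P x - w - f x)‖ < δ / 2 := by
    intro x
    rw [norm_smul, Real.norm_of_nonneg (hc0 x)]
    exact (mul_le_of_le_one_left (norm_nonneg _) (hc1 x)).trans_lt (hd x)
  refine ⟨fun x => f x + c x • (P x - w - f x), ?_, ?_, ?_, ?_⟩
  · have := hP.continuous
    fun_prop
  · intro x hx
    rcases le_or_gt ‖f x‖ (δ / 2) with h | h
    · have : c x = 1 := by
        have : 2 * ‖f x‖ / δ ≤ 1 := by rw [div_le_one hδ]; linarith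
        simp only [hc]
        rw [min_eq_left (by linarith), max_eq_right zero_le_one]
      simp only [this, one_smul] at hx
      exact hw ⟨x, by rw [← sub_eq_zero, ← hx]; abel⟩
    · have h2 : f x = -(c x • (P x - w - f x)) := eq_neg_of_add_eq_zero_left hx
      have h3 := hcd x
      rw [← norm_neg, ← h2] at h3
      linarith
  · intro x hx
    have : c x = 0 := by
      have : 2 ≤ 2 * ‖f x‖ / δ := by rw [le_div_iff₀ hδ]; linarith
      simp only [hc]
      rw [min_eq_right (by linarith), max_eq_left (by linarith)]
    simp [this]
  · intro x
    have := hcd x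
    simp only [add_sub_cancel_left]
    linarith

/-- Nearby points of a compact set have nearby lifts through an open surjection. -/
theorem IsCompact.exists_close_lifts {V Y Z : Type*} [PseudoMetricSpace V] [TopologicalSpace Y]
    [PseudoMetricSpace Z] {π : V → Y} (hπo : IsOpenMap π) (hπs : Function.Surjective π)
    {θ : Z → Y} (hθ : Continuous θ) {K : Set Z} (hK : IsCompact K) {η : ℝ} (hη : 0 < η) :
    ∃ μ > 0, ∀ y ∈ K, ∀ y', dist y' y < μ →
      ∃ x x', π x = θ y ∧ π x' = θ y' ∧ dist x x' < η := by
  obtain ⟨μ, hμ, h⟩ := lebesgue_number_lemma_of_metric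
    (c := fun v : V => θ ⁻¹' (π '' Metric.ball v (η / 2))) hK
    (fun v => (hπo _ Metric.isOpen_ball).preimage hθ) (by
      intro y _
      obtain ⟨v, hv⟩ := hπs (θ y)
      exact Set.mem_iUnion.2 ⟨v, v, Metric.mem_ball_self (by positivity), hv⟩)
  refine ⟨μ, hμ, fun y hy y' hyy' => ?_⟩
  obtain ⟨v, hv⟩ := h y hy
  obtain ⟨x, hx, hxy⟩ := hv (Metric.mem_ball_self hμ)
  obtain ⟨x', hx', hxy'⟩ := hv (Metric.mem_ball.2 hyy')
  refine ⟨x, x', hxy, hxy', ?_⟩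
  have := dist_triangle_right x x' v
  rw [Metric.mem_ball] at hx hx'
  linarith

section FiniteGroupAction

variable {V Γ : Type*} [NormedAddCommGroup V] [NormedSpace ℝ V] [FiniteDimensional ℝ V]
  [Group Γ] [Finite Γ] (ρ : Γ →* (V →ₗ[ℝ] V))

theorem exists_forall_norm_le_of_finite : ∃ C > 0, ∀ g x, ‖ρ g x‖ ≤ C * ‖x‖ := by
  obtain ⟨C, hC⟩ := (Set.finite_range fun g => ‖LinearMap.toContinuousLinearMap (ρ g)‖).bddAbove
  refine ⟨max C 1, by positivity, fun g x => ?_⟩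
  refine ((LinearMap.toContinuousLinearMap (ρ g)).le_opNorm x).trans ?_
  gcongr
  exact (hC ⟨g, rfl⟩).trans (le_max_left _ _)

/-- Elements moving a point near `v` to a point near `v` fix `v`. -/
theorem exists_pos_forall_fixes (v : V) :
    ∃ τ > 0, ∀ g x y, ‖x - v‖ < τ → ‖y - v‖ < τ → ‖ρ g x - y‖ < τ → ρ g v = v := by
  obtain ⟨C, hC, hCb⟩ := exists_forall_norm_le_of_finite ρ
  have hev : ∀ᶠ τ : ℝ in nhdsWithin 0 (Set.Ioi 0), ∀ g, ρ g v ≠ v →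
      (C + 2) * τ < ‖ρ g v - v‖ := by
    refine Filter.eventually_all.2 fun g => ?_
    by_cases hg : ρ g v = v
    · simp [hg]
    · have hpos : 0 < ‖ρ g v - v‖ := norm_pos_iff.2 (sub_ne_zero.2 hg)
      have hcont : Continuous fun τ : ℝ => (C + 2) * τ := by fun_prop
      have : ∀ᶠ τ : ℝ in nhds 0, (C + 2) * τ < ‖ρ g v - v‖ :=
        hcont.continuousAt.eventually_lt continuousAt_const (by simpa using hpos)
      exact (this.filter_mono nhdsWithin_le_nhds).mono fun τ h _ => h
  obtain ⟨τ, hτ, hτ0⟩ := (hev.and self_mem_nhdsWithin).exists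
  refine ⟨τ, hτ0, fun g x y hx hy hxy => ?_⟩
  by_contra hg
  have h1 : ‖ρ g v - v‖ ≤ ‖ρ g (v - x)‖ + ‖ρ g x - y‖ + ‖y - v‖ := by
    rw [map_sub]
    calc ‖ρ g v - v‖ = ‖(ρ g v - ρ g x) + (ρ g x - y) + (y - v)‖ := by congr 1; abel
      _ ≤ _ := norm_add₃_le
  have h2 := hCb g (v - x)
  rw [norm_sub_rev v x] at h2
  have h3 : C * ‖x - v‖ ≤ C * τ := by gcongr
  have h4 := hτ g hg
  linarith

theorem exists_pos_forall_norm_le_of_free {W : Type*} [NormedAddCommGroup W] [NormedSpace ℝ W]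
    (f : V →ₗ[ℝ] W) (S : Set Γ) (hfree : ∀ g ∈ S, ∀ x, f x = 0 → ρ g x = x → x = 0) :
    ∃ κ > 0, ∀ g ∈ S, ∀ x, ‖x‖ ≤ κ * (‖ρ g x - x‖ + ‖f x‖) := by
  have h : ∀ g, ∃ κ : ℝ, g ∈ S → ∀ x, ‖x‖ ≤ κ * (‖ρ g x - x‖ + ‖f x‖) := by
    intro g
    by_cases hg : g ∈ S
    swap
    · exact ⟨0, fun h => absurd h hg⟩
    obtain ⟨κ, -, hκ⟩ := ((ρ g - LinearMap.id).prod f).exists_antilipschitzWith (by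
      rw [LinearMap.ker_eq_bot']
      intro x hx
      have hx' : (ρ g x - x, f x) = 0 := hx
      rw [Prod.mk_eq_zero, sub_eq_zero] at hx'
      exact hfree g hg x hx'.2 hx'.1)
    refine ⟨κ, fun _ x => ?_⟩
    have h1 := hκ.le_mul_dist x 0
    simp only [dist_zero_right, map_zero] at h1
    refine h1.trans ?_
    gcongr
    change max ‖ρ g x - x‖ ‖f x‖ ≤ _
    exact max_le_add_of_nonneg (norm_nonneg _) (norm_nonneg _)
  choose κ hκ using h
  obtain ⟨K, hK⟩ := (Set.finite_range κ).bddAbove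
  refine ⟨max K 1, by positivity, fun g hg x => (hκ g hg x).trans ?_⟩
  gcongr
  exact (hK ⟨g, rfl⟩).trans (le_max_left _ _)

end FiniteGroupAction

section ModelLift

variable {V : Type*} [NormedAddCommGroup V] [NormedSpace ℝ V] {r : ℕ}
  (T : V →ₗ[ℝ] V) (a : (Fin r → ℝ) →ₗ[ℝ] V) (w q : V)

/-- The first `r` of `r + 2` coordinates. -/
def initCoords (x : Fin (r + 2) → ℝ) : Fin r → ℝ := fun j => x j.castSucc.castSucc

/-- The lift of the model boundary map where the `r`-th coordinate is nonpositive. -/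
def modelLeft (x : Fin (r + 2) → ℝ) : V :=
  a (initCoords x) + (|x (Fin.last r).castSucc| + |x (Fin.last (r + 1))|) • w

/-- The lift of the model boundary map where the `r`-th coordinate is nonnegative. -/
def modelRight (x : Fin (r + 2) → ℝ) : V :=
  a (initCoords x) + (max (x (Fin.last (r + 1))) 0 • w + max (-x (Fin.last (r + 1))) 0 • T w +
    x (Fin.last r).castSucc • q)

/-- A discontinuous lift of the model boundary map, jumping by `T` across a half-hyperplane. -/
noncomputable def modelLift (x : Fin (r + 2) → ℝ) : V :=
  if x (Fin.last r).castSucc ≤ 0 then modelLeft a w x else modelRight T a w q x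

theorem continuous_initCoords : Continuous (initCoords (r := r)) := by
  unfold initCoords; fun_prop

theorem continuous_modelLeft : Continuous (modelLeft a w) := by
  have := (LinearMap.continuous_of_finiteDimensional a).comp continuous_initCoords
  unfold modelLeft
  exact this.add (by fun_prop)

theorem continuous_modelRight : Continuous (modelRight T a w q) := by
  have := (LinearMap.continuous_of_finiteDimensional a).comp continuous_initCoords
  unfold modelRight
  exact this.add (by fun_prop)

variable {T a w q}

theorem modelRight_eq_modelLeft {x : Fin (r + 2) → ℝ} (hs : x (Fin.last r).castSucc = 0)
    (ht : 0 ≤ x (Fin.last (r + 1))) : modelRight T a w q x = modelLeft a w x := by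
  simp [modelRight, modelLeft, hs, ht, abs_of_nonneg ht]

theorem modelRight_eq_map_modelLeft (hT : ∀ y, T (a y) = a y) {x : Fin (r + 2) → ℝ}
    (hs : x (Fin.last r).castSucc = 0) (ht : x (Fin.last (r + 1)) ≤ 0) :
    modelRight T a w q x = T (modelLeft a w x) := by
  simp [modelRight, modelLeft, hs, ht, abs_of_nonpos ht, hT]

theorem modelLift_eq_zero {f : V →ₗ[ℝ] Fin r → ℝ} (hfa : ∀ y, f (a y) = y) (hfw : f w = 0)
    (hfT : f (T w) = 0) (hfq : f q = 0) (hw : w ≠ 0)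
    (hq : q ∉ Submodule.span ℝ {w, T w}) {x : Fin (r + 2) → ℝ} (hx : modelLift T a w q x = 0) :
    x = 0 := by
  have hinit : initCoords x = 0 := by
    have := congrArg f hx
    unfold modelLift at this
    split_ifs at this <;> simpa [modelLeft, modelRight, hfa, hfw, hfT, hfq] using this
  have h2 : x (Fin.last r).castSucc = 0 ∧ x (Fin.last (r + 1)) = 0 := by
    unfold modelLift at hx
    split_ifs at hx with hs
    · rw [modelLeft, hinit, map_zero, zero_add, smul_eq_zero_iff_left hw] at hx
      have h1 := abs_nonneg (x (Fin.last r).castSucc)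
      have h2 := abs_nonneg (x (Fin.last (r + 1)))
      exact ⟨abs_eq_zero.1 (by linarith), abs_eq_zero.1 (by linarith)⟩
    · exfalso
      push Not at hs
      rw [modelRight, hinit, map_zero, zero_add] at hx
      refine hq ?_
      have h3 : q = (x (Fin.last r).castSucc)⁻¹ • (-(max (x (Fin.last (r + 1))) 0 • w +
          max (-x (Fin.last (r + 1))) 0 • T w)) := by
        rw [← eq_neg_of_add_eq_zero_right hx, smul_smul, inv_mul_cancel₀ hs.ne', one_smul]
      rw [h3]
      refine Submodule.smul_mem _ _ (Submodule.neg_mem _ (Submodule.add_mem _ ?_ ?_)) <;>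
        exact Submodule.smul_mem _ _ (Submodule.subset_span (by simp))
  funext i
  refine Fin.lastCases h2.2 (fun i => Fin.lastCases h2.1 (fun j => congrFun hinit j) i) i

theorem map_modelLift {f : V →ₗ[ℝ] Fin r → ℝ} (hfa : ∀ y, f (a y) = y) (hfw : f w = 0)
    (hfT : f (T w) = 0) (hfq : f q = 0) (x : Fin (r + 2) → ℝ) :
    f (modelLift T a w q x) = initCoords x := by
  unfold modelLift
  split_ifs <;> simp [modelLeft, modelRight, hfa, hfw, hfT, hfq]

end ModelLift

/-- The point of the cube `[-1, 1]ᴺ` with grid coordinates `x ∈ {0, …, 2m}ᴺ`. -/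
noncomputable def gridPoint {N : ℕ} (m : ℕ) (x : Fin N → ℕ) : Fin N → ℝ := fun i => x i / m - 1

theorem norm_gridPoint_le_one {N m : ℕ} (hm : 0 < m) {x : Fin N → ℕ} (hx : ∀ i, x i ≤ 2 * m) :
    ‖gridPoint m x‖ ≤ 1 := by
  refine (pi_norm_le_iff_of_nonneg zero_le_one).2 fun i => ?_
  have hm' : (0 : ℝ) < m := by exact_mod_cast hm
  have h1 : (x i : ℝ) / m ≤ 2 := by
    rw [div_le_iff₀ hm']; exact_mod_cast hx i
  have h2 : 0 ≤ (x i : ℝ) / m := by positivity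
  rw [Real.norm_eq_abs, gridPoint, abs_le]
  constructor <;> linarith

theorem norm_gridPoint_eq_one {N m : ℕ} (hm : 0 < m) {x : Fin N → ℕ} (hx : ∀ i, x i ≤ 2 * m)
    (hb : ∃ i, x i = 0 ∨ x i = 2 * m) : ‖gridPoint m x‖ = 1 := by
  refine le_antisymm (norm_gridPoint_le_one hm hx) ?_
  obtain ⟨i, hi⟩ := hb
  refine le_trans ?_ (norm_le_pi_norm _ i)
  have hm' : (m : ℝ) ≠ 0 := by exact_mod_cast hm.ne'
  rcases hi with hi | hi <;> simp only [gridPoint, hi]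
  · simp
  · push_cast
    rw [mul_div_cancel_right₀ _ hm']
    norm_num

theorem dist_gridPoint_le {N m : ℕ} {x y v : Fin N → ℕ}
    (hx : ∀ i, v i ≤ x i ∧ x i ≤ v i + 1) (hy : ∀ i, v i ≤ y i ∧ y i ≤ v i + 1) :
    dist (gridPoint m x) (gridPoint m y) ≤ 1 / m := by
  refine (dist_pi_le_iff (by positivity)).2 fun i => ?_
  rw [Real.dist_eq]
  have : gridPoint m x i - gridPoint m y i = ((x i : ℝ) - y i) / m := by
    simp only [gridPoint]; ring
  rw [this, abs_div, Nat.abs_cast]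
  gcongr
  have h1 := hx i
  have h2 := hy i
  have h3 : (v i : ℝ) ≤ x i := by exact_mod_cast h1.1
  have h4 : (x i : ℝ) ≤ v i + 1 := by exact_mod_cast h1.2
  have h5 : (v i : ℝ) ≤ y i := by exact_mod_cast h2.1
  have h6 : (y i : ℝ) ≤ v i + 1 := by exact_mod_cast h2.2
  rw [abs_le]
  constructor <;> linarith

theorem gridPoint_pos_iff {N m : ℕ} (hm : 0 < m) {x : Fin N → ℕ} {i : Fin N} :
    0 < gridPoint m x i ↔ m < x i := by
  have hm' : (0 : ℝ) < m := by exact_mod_cast hm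
  rw [gridPoint, sub_pos, one_lt_div hm', Nat.cast_lt]

/-- If `π` is the orbit map of a finite linear group and the orbit space has an `M`-dimensional
chart `θ` at `π v`, then a small map `x ↦ π (v + ε • b x)` on a cube of dimension less than `M`
can be modified, away from the boundary, to avoid `π v`. The result is described by lifts. -/
theorem exists_lift_avoiding {V Γ Y : Type*} [NormedAddCommGroup V] [NormedSpace ℝ V]
    [Group Γ] {ρ : Γ →* (V →ₗ[ℝ] V)} [TopologicalSpace Y] {π : V → Y} (hπc : Continuous π)
    (hπo : IsOpenMap π) (hπs : Function.Surjective π) (hπ : ∀ x y, π x = π y ↔ ∃ g, ρ g x = y)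
    {C : ℝ} (hC : 0 < C) (hρC : ∀ g x, ‖ρ g x‖ ≤ C * ‖x‖)
    {M N : ℕ} (hNM : N < M) {θ : (Fin M → ℝ) → Y} (hθ : Topology.IsOpenEmbedding θ) {v : V}
    (hv : θ 0 = π v) {τ : ℝ} (hτ : 0 < τ)
    (hfix : ∀ g x y, ‖x - v‖ < τ → ‖y - v‖ < τ → ‖ρ g x - y‖ < τ → ρ g v = v)
    {b : (Fin N → ℝ) → V} {D : ℝ} (hD : ∀ x, ‖x‖ ≤ 1 → ‖b x‖ ≤ D)
    (hb : ∀ ε : ℝ, Continuous fun x => π (v + ε • b x)) (hb0 : ∀ x, b x = 0 → x = 0) :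
    ∃ ε > (0 : ℝ), ∃ δ > (0 : ℝ), ∃ ℓ : (Fin N → ℝ) → V,
      (∀ x, ‖x‖ ≤ 1 → ‖ℓ x - v‖ < τ ∧ δ ≤ ‖ℓ x - v‖) ∧
      (∀ x, ‖x‖ = 1 → ℓ x = v + ε • b x) ∧
      ∀ η > (0 : ℝ), ∃ μ > (0 : ℝ), ∀ x y, ‖x‖ ≤ 1 → ‖y‖ ≤ 1 → dist x y < μ →
        ∃ g, ‖ρ g (ℓ x) - ℓ y‖ < η := by
  have hθc := hθ.continuous
  have hK : IsCompact (Metric.closedBall (0 : Fin N → ℝ) 1) := isCompact_closedBall _ _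
  obtain ⟨R, hR, hRl⟩ : ∃ R > 0, ∀ y, ‖y‖ < R → ∃ z, ‖z - v‖ < τ ∧ π z = θ y := by
    have : θ ⁻¹' (π '' Metric.ball v τ) ∈ nhds 0 :=
      ((hπo _ Metric.isOpen_ball).preimage hθc).mem_nhds ⟨v, Metric.mem_ball_self hτ, hv.symm⟩
    obtain ⟨R, hR, h⟩ := Metric.mem_nhds_iff.1 this
    refine ⟨R, hR, fun y hy => ?_⟩
    obtain ⟨z, hz, hzy⟩ := h (mem_ball_zero_iff.2 hy)
    exact ⟨z, mem_ball_iff_norm.1 hz, hzy⟩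
  have hpull : ∀ μ > (0 : ℝ), ∃ ε > (0 : ℝ), ∀ z, ‖z - v‖ < ε → ∃ y, ‖y‖ < μ ∧ θ y = π z := by
    intro μ hμ
    have : π ⁻¹' (θ '' Metric.ball 0 μ) ∈ nhds v :=
      ((hθ.isOpenMap _ Metric.isOpen_ball).preimage hπc).mem_nhds
        ⟨0, Metric.mem_ball_self hμ, hv⟩
    obtain ⟨ε, hε, h⟩ := Metric.mem_nhds_iff.1 this
    refine ⟨ε, hε, fun z hz => ?_⟩
    obtain ⟨y, hy, hyz⟩ := h (mem_ball_iff_norm.2 hz)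
    exact ⟨y, mem_ball_zero_iff.1 hy, hyz⟩
  obtain ⟨ε₂, hε₂, hpull₂⟩ := hpull (R / 2) (by positivity)
  have hD0 : 0 ≤ D := (norm_nonneg _).trans (hD 0 (by simp))
  obtain ⟨ε, hε, hετ, hεε₂⟩ : ∃ ε > (0 : ℝ), ε * D < τ ∧ ε * D < ε₂ := by
    have hmin : 0 < min τ ε₂ := lt_min hτ hε₂
    refine ⟨min τ ε₂ / (D + 1), by positivity, ?_⟩
    rw [← lt_min_iff, div_mul_eq_mul_div, div_lt_iff₀ (by positivity)]
    nlinarith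
  have hnorm : ∀ x, ‖x‖ ≤ 1 → ‖v + ε • b x - v‖ ≤ ε * D := by
    intro x hx
    rw [add_sub_cancel_left, norm_smul, Real.norm_of_nonneg hε.le]
    gcongr
    exact hD x hx
  have hG₀ : ∀ x, ‖x‖ ≤ 1 → ∃ y, ‖y‖ < R / 2 ∧ θ y = π (v + ε • b x) := fun x hx =>
    hpull₂ _ ((hnorm x hx).trans_lt hεε₂)
  choose! G₀ hG₀R hG₀ using hG₀
  have hG₀c : ContinuousOn G₀ (Metric.closedBall 0 1) := by
    rw [hθ.isInducing.continuousOn_iff]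
    exact (hb ε).continuousOn.congr fun x hx => hG₀ x (mem_closedBall_zero_iff.1 hx)
  obtain ⟨G₁, hG₁⟩ := ContinuousMap.exists_restrict_eq Metric.isClosed_closedBall
    (⟨_, hG₀c.domRestrict⟩ : C(Metric.closedBall (0 : Fin N → ℝ) 1, Fin M → ℝ))
  have hG₁eq : ∀ x, ‖x‖ ≤ 1 → G₁ x = G₀ x := fun x hx =>
    congrArg (fun φ => φ ⟨x, mem_closedBall_zero_iff.2 hx⟩) hG₁
  obtain ⟨δ₀, hδ₀, hδ₀le⟩ := (isCompact_sphere (0 : Fin N → ℝ) 1).exists_forall_le'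
    (f := fun x => ‖G₁ x‖) (a := 0) G₁.continuous.norm.continuousOn (by
      intro x hx
      rw [mem_sphere_zero_iff_norm] at hx
      rw [norm_pos_iff, hG₁eq x hx.le]
      intro h0
      have h1 := hG₀ x hx.le
      rw [h0, hv, eq_comm, hπ] at h1
      obtain ⟨g, hg⟩ := h1
      have hgv := hfix g (v + ε • b x) v ((hnorm x hx.le).trans_lt hετ) (by simpa using hτ)
        (by simpa [hg] using hτ)
      have h2 : ρ g (ε • b x) = 0 := by
        rw [map_add, hgv, add_eq_left] at hg
        exact hg
      have h3 : ε • b x = 0 := by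
        have := congrArg (ρ g⁻¹) h2
        rwa [map_zero, ← Module.End.mul_apply, ← map_mul, inv_mul_cancel, map_one,
          Module.End.one_apply] at this
      rw [smul_eq_zero_iff_right hε.ne'] at h3
      rw [hb0 x h3, norm_zero] at hx
      exact zero_ne_one hx)
  obtain ⟨G, hGc, hG0, hGeq, hGd⟩ := G₁.continuous.exists_ne_zero_of_finrank_lt
    (by simpa using hNM) (δ := min (R / 2) δ₀) (by positivity)
  have hGR : ∀ x, ‖x‖ ≤ 1 → ‖G x‖ < R := by
    intro x hx
    have h1 := (hGd x).trans_le (min_le_left _ _)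
    have h2 := hG₀R x hx
    rw [← hG₁eq x hx] at h2
    have h3 := norm_sub_norm_le (G x) (G₁ x)
    linarith
  have hℓ : ∀ x, ‖x‖ ≤ 1 → ∃ z, ‖z - v‖ < τ ∧ π z = θ (G x) ∧ (‖x‖ = 1 → z = v + ε • b x) := by
    intro x hx
    by_cases hx1 : ‖x‖ = 1
    · refine ⟨v + ε • b x, (hnorm x hx).trans_lt hετ, ?_, fun _ => rfl⟩
      rw [hGeq x ((min_le_right _ _).trans (hδ₀le x (mem_sphere_zero_iff_norm.2 hx1))),
        hG₁eq x hx, hG₀ x hx]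
    · obtain ⟨z, hz, hz'⟩ := hRl _ (hGR x hx)
      exact ⟨z, hz, hz', fun h => absurd h hx1⟩
  choose! ℓ hℓτ hℓπ hℓb using hℓ
  obtain ⟨μ₀, hμ₀, hμ₀le⟩ := hK.exists_forall_le' (f := fun x => ‖G x‖) (a := 0)
    hGc.norm.continuousOn fun x _ => norm_pos_iff.2 (hG0 x)
  obtain ⟨δ, hδ, hδl⟩ := hpull μ₀ hμ₀
  refine ⟨ε, hε, δ, hδ, ℓ, fun x hx => ⟨hℓτ x hx, ?_⟩, fun x hx => hℓb x hx.le hx, ?_⟩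
  · by_contra! hlt
    obtain ⟨y, hy, hyx⟩ := hδl _ hlt
    rw [hℓπ x hx] at hyx
    rw [hθ.injective hyx] at hy
    exact absurd hy (not_lt.2 (hμ₀le x (mem_closedBall_zero_iff.2 hx)))
  · intro η hη
    obtain ⟨μ, hμ, h⟩ := hK.exists_close_lifts hπo hπs (hθc.comp hGc) (η := η / C) (by positivity)
    refine ⟨μ, hμ, fun x y hx hy hxy => ?_⟩
    obtain ⟨z, z', hz, hz', hzz'⟩ := h x (mem_closedBall_zero_iff.2 hx) y (by rwa [dist_comm])
    obtain ⟨g, hg⟩ := (hπ _ _).1 ((hℓπ x hx).trans hz.symm)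
    obtain ⟨g', hg'⟩ := (hπ _ _).1 (hz'.trans (hℓπ y hy).symm)
    refine ⟨g' * g, ?_⟩
    rw [map_mul, Module.End.mul_apply, hg, ← hg', ← map_sub]
    refine (hρC _ _).trans_lt ?_
    rw [dist_eq_norm, lt_div_iff₀ hC] at hzz'
    linarith

theorem modelLift_of_le {V : Type*} [NormedAddCommGroup V] [NormedSpace ℝ V] {r m : ℕ} (hm : 0 < m)
    {T : V →ₗ[ℝ] V} {a : (Fin r → ℝ) →ₗ[ℝ] V} {w q : V} {x : Fin (r + 2) → ℕ}
    (hx : x (Fin.last r).castSucc ≤ m) :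
    modelLift T a w q (gridPoint m x) = modelLeft a w (gridPoint m x) :=
  if_pos (not_lt.1 fun h => absurd ((gridPoint_pos_iff hm).1 h) (not_lt.2 hx))

theorem modelLift_of_lt {V : Type*} [NormedAddCommGroup V] [NormedSpace ℝ V] {r m : ℕ} (hm : 0 < m)
    {T : V →ₗ[ℝ] V} {a : (Fin r → ℝ) →ₗ[ℝ] V} {w q : V} {x : Fin (r + 2) → ℕ}
    (hx : m < x (Fin.last r).castSucc) :
    modelLift T a w q (gridPoint m x) = modelRight T a w q (gridPoint m x) :=
  if_neg (not_le.2 ((gridPoint_pos_iff hm).2 hx))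

theorem exists_pos_dist_lt_of_continuous {E V : Type*} [NormedAddCommGroup E] [ProperSpace E]
    [NormedAddCommGroup V] {b : E → V} (hb : Continuous b) {η : ℝ} (hη : 0 < η) :
    ∃ μ > 0, ∀ x y, ‖x‖ ≤ 1 → ‖y‖ ≤ 1 → dist x y < μ → ‖b x - b y‖ < η := by
  have h := (isCompact_closedBall (0 : E) 1).uniformContinuousOn_of_continuous hb.continuousOn
  obtain ⟨μ, hμ, h⟩ := Metric.uniformContinuousOn_iff.1 h η hη
  refine ⟨μ, hμ, fun x y hx hy hxy => ?_⟩
  rw [← dist_eq_norm]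
  exact h x (mem_closedBall_zero_iff.2 hx) y (mem_closedBall_zero_iff.2 hy) hxy

section GridLift

variable {V Γ : Type*} [NormedAddCommGroup V] [NormedSpace ℝ V] [FiniteDimensional ℝ V]
  [CommGroup Γ] [Finite Γ] {ρ : Γ →* (V →ₗ[ℝ] V)}

/-- Away from `v`, elements of the stabilizer of `v` are determined by their approximate values
at points near the fixed subspace. -/
theorem exists_pos_forall_eq {W : Type*} [NormedAddCommGroup W] [NormedSpace ℝ W] {v : V}
    {f : V →ₗ[ℝ] W} (hfree : ∀ g, ρ g v = v → g ≠ 1 → ∀ x, f x = 0 → ρ g x = x → x = 0)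
    {C : ℝ} (hC : 0 < C) (hρC : ∀ g x, ‖ρ g x‖ ≤ C * ‖x‖) {B : ℝ} (hB : 0 < B)
    {δ τ : ℝ} (hδ : 0 < δ) (hτ : 0 < τ) :
    ∃ η > 0, η ≤ τ ∧ ∀ x g g', ρ g v = v → ρ g' v = v → δ ≤ ‖x - v‖ →
      ‖f x - f v‖ ≤ 2 * B * η → ‖ρ g x - ρ g' x‖ ≤ (C + 2) * η → g = g' := by
  obtain ⟨κ, hκ, h⟩ := exists_pos_forall_norm_le_of_free ρ f {g | ρ g v = v ∧ g ≠ 1}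
    fun g hg => hfree g hg.1 hg.2
  have hK : 0 < κ * (C * (C + 2) + 2 * B) := by positivity
  obtain ⟨η, hη, hηδ⟩ := exists_between
    (show 0 < min τ (δ / (κ * (C * (C + 2) + 2 * B))) by positivity)
  refine ⟨η, hη, (hηδ.trans_le (min_le_left _ _)).le, fun x g g' hg hg' hx hfx hgx => ?_⟩
  have hηδ' := hηδ.trans_le (min_le_right _ _)
  rw [lt_div_iff₀ hK] at hηδ'
  have hinv : ∀ y, ρ g'⁻¹ (ρ g' y) = y := fun y => by
    rw [← Module.End.mul_apply, ← map_mul, inv_mul_cancel, map_one, Module.End.one_apply]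
  have hgv : ρ (g'⁻¹ * g) v = v := by
    rw [map_mul, Module.End.mul_apply, hg]
    nth_rw 1 [← hg']
    exact hinv v
  by_contra hne
  have h1 := h (g'⁻¹ * g) ⟨hgv, fun h1 => hne (inv_mul_eq_one.1 h1).symm⟩ (x - v)
  have h2 : ρ (g'⁻¹ * g) (x - v) - (x - v) = ρ g'⁻¹ (ρ g x - ρ g' x) := by
    rw [map_sub, hgv, map_sub, hinv, map_mul, Module.End.mul_apply]
    abel
  have h3 : ‖ρ g'⁻¹ (ρ g x - ρ g' x)‖ ≤ C * ((C + 2) * η) := (hρC _ _).trans (by gcongr)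
  rw [h2, map_sub f] at h1
  have h4 : κ * (‖ρ g'⁻¹ (ρ g x - ρ g' x)‖ + ‖f x - f v‖) ≤
      κ * (C * ((C + 2) * η) + 2 * B * η) := by gcongr
  linarith

/-- The lifts along a grid cannot extend the model lifts on the boundary of the cube. -/
theorem false_of_lift {r : ℕ} {v : V} {f : V →ₗ[ℝ] Fin r → ℝ} {a : (Fin r → ℝ) →ₗ[ℝ] V}
    (hfa : ∀ y, f (a y) = y) (hfρ : ∀ g, ρ g v = v → ∀ x, f (ρ g x) = f x)
    (haρ : ∀ g, ρ g v = v → ∀ y, ρ g (a y) = a y)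
    (hfree : ∀ g, ρ g v = v → g ≠ 1 → ∀ x, f x = 0 → ρ g x = x → x = 0)
    {h₀ : Γ} (hh₀ : ρ h₀ v = v) (hh₀1 : h₀ ≠ 1) {w q : V} (hfw : f w = 0) (hfq : f q = 0)
    {C : ℝ} (hC : 0 < C) (hρC : ∀ g x, ‖ρ g x‖ ≤ C * ‖x‖) {τ : ℝ} (hτ : 0 < τ)
    (hfix : ∀ g x y, ‖x - v‖ < τ → ‖y - v‖ < τ → ‖ρ g x - y‖ < τ → ρ g v = v)
    {ε δ : ℝ} (hε : 0 < ε) (hδ : 0 < δ) {ℓ : (Fin (r + 2) → ℝ) → V}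
    (hℓ : ∀ x, ‖x‖ ≤ 1 → ‖ℓ x - v‖ < τ ∧ δ ≤ ‖ℓ x - v‖)
    (hℓb : ∀ x, ‖x‖ = 1 → ℓ x = v + ε • modelLift (ρ h₀) a w q x)
    (hclose : ∀ η > (0 : ℝ), ∃ μ > (0 : ℝ), ∀ x y, ‖x‖ ≤ 1 → ‖y‖ ≤ 1 → dist x y < μ →
      ∃ g, ‖ρ g (ℓ x) - ℓ y‖ < η) : False := by
  classical
  obtain ⟨B, hB, hfB⟩ : ∃ B > 0, ∀ x, ‖f x‖ ≤ B * ‖x‖ :=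
    ⟨‖LinearMap.toContinuousLinearMap f‖ + 1, by positivity, fun x =>
      ((LinearMap.toContinuousLinearMap f).le_opNorm x).trans (by gcongr; linarith)⟩
  obtain ⟨η, hη, hητ, huniq⟩ := exists_pos_forall_eq hfree hC hρC hB hδ hτ
  obtain ⟨μ, hμ, hμℓ⟩ := hclose η hη
  obtain ⟨μL, hμL, hL⟩ := exists_pos_dist_lt_of_continuous (continuous_modelLeft a w)
    (div_pos hη hε)
  obtain ⟨μR, hμR, hR⟩ := exists_pos_dist_lt_of_continuous (continuous_modelRight (ρ h₀) a w q)
    (div_pos hη hε)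
  obtain ⟨k, hk⟩ := exists_nat_one_div_lt
    (show 0 < min (min μ (2 * B * η / ε)) (min μL μR) by positivity)
  obtain ⟨m, hm, hmμ, hmε, hmL, hmR⟩ : ∃ m : ℕ, 0 < m ∧ (1 : ℝ) / m < μ ∧
      (1 : ℝ) / m < 2 * B * η / ε ∧ (1 : ℝ) / m < μL ∧ (1 : ℝ) / m < μR := by
    refine ⟨k + 1, k.succ_pos, ?_⟩
    push_cast
    rw [lt_min_iff, lt_min_iff, lt_min_iff] at hk
    exact ⟨hk.1.1, hk.1.2, hk.2.1, hk.2.2⟩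
  set t : (Fin (r + 2) → ℝ) → (Fin (r + 2) → ℝ) → Γ := fun x y =>
    if h : ∃ g, ‖ρ g (ℓ x) - ℓ y‖ < η then h.choose else 1 with ht
  have ht_spec : ∀ {x y g}, ‖ρ g (ℓ x) - ℓ y‖ < η → ‖ρ (t x y) (ℓ x) - ℓ y‖ < η := by
    intro x y g hg
    have h : ∃ g, ‖ρ g (ℓ x) - ℓ y‖ < η := ⟨g, hg⟩
    simp only [ht, dif_pos h]
    exact h.choose_spec
  have hstab : ∀ {x y g}, ‖x‖ ≤ 1 → ‖y‖ ≤ 1 → ‖ρ g (ℓ x) - ℓ y‖ < η → ρ g v = v :=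
    fun hx hy hg => hfix _ _ _ (hℓ _ hx).1 (hℓ _ hy).1 (hg.trans_le hητ)
  have ht_eq : ∀ {x y g}, ‖x‖ ≤ 1 → ‖y‖ ≤ 1 → ‖f (ℓ x) - f v‖ ≤ 2 * B * η →
      ‖ρ g (ℓ x) - ℓ y‖ < η → t x y = g := by
    intro x y g hx hy hfx hg
    have hg' := ht_spec hg
    refine huniq (ℓ x) _ _ (hstab hx hy hg') (hstab hx hy hg) (hℓ x hx).2 hfx ?_
    have := norm_sub_le_norm_sub_add_norm_sub (ρ (t x y) (ℓ x)) (ℓ y) (ρ g (ℓ x))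
    rw [norm_sub_rev (ℓ y)] at this
    nlinarith
  have htri : ∀ {x y z g g' g''}, ‖ρ g x - y‖ < η → ‖ρ g' y - z‖ < η → ‖ρ g'' x - z‖ < η →
      ‖ρ g'' x - ρ g' (ρ g x)‖ ≤ (C + 2) * η := by
    intro x y z g g' g'' h01 h12 h02
    have h := norm_sub_le_norm_sub_add_norm_sub (ρ g'' x) z (ρ g' (ρ g x))
    have h' := norm_sub_le_norm_sub_add_norm_sub z (ρ g' y) (ρ g' (ρ g x))
    have h'' := (hρC g' (y - ρ g x)).trans
      (mul_le_mul_of_nonneg_left (norm_sub_rev y _ ▸ h01.le) hC.le)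
    rw [map_sub] at h''
    rw [norm_sub_rev z (ρ g' y)] at h'
    linarith
  have hfdiff : ∀ {x y}, ‖x‖ ≤ 1 → ‖y‖ ≤ 1 → dist x y < μ → ‖f (ℓ x) - f (ℓ y)‖ ≤ B * η := by
    intro x y hx hy hxy
    obtain ⟨g, hg⟩ := hμℓ x y hx hy hxy
    rw [← hfρ g (hstab hx hy hg), ← map_sub]
    exact (hfB _).trans (by gcongr)
  have hfℓ : ∀ x, ‖x‖ = 1 → f (ℓ x) = f v + ε • initCoords x := by
    intro x hx
    rw [hℓb x hx, map_add, map_smul, map_modelLift hfa hfw (by rw [hfρ _ hh₀, hfw]) hfq]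
  have hedge : ∀ {x y : Fin (r + 2) → ℕ} {g : Γ}, ‖gridPoint m x‖ = 1 → ‖gridPoint m y‖ = 1 →
      (∀ j : Fin r, x j.castSucc.castSucc = m + 1) → ρ g v = v →
      ‖ρ g (modelLift (ρ h₀) a w q (gridPoint m x)) -
        modelLift (ρ h₀) a w q (gridPoint m y)‖ < η / ε →
      t (gridPoint m x) (gridPoint m y) = g := by
    intro x y g hx hy hxj hg hxy
    refine ht_eq hx.le hy.le ?_ ?_
    · rw [hfℓ _ hx, add_sub_cancel_left, norm_smul, Real.norm_of_nonneg hε.le]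
      rw [lt_div_iff₀ hε] at hmε
      have : ‖initCoords (gridPoint m x)‖ ≤ 1 / m := by
        refine (pi_norm_le_iff_of_nonneg (by positivity)).2 fun j => le_of_eq ?_
        have hm' : (m : ℝ) ≠ 0 := by exact_mod_cast hm.ne'
        have : initCoords (gridPoint m x) j = 1 / m := by
          simp only [initCoords, gridPoint, hxj]
          push_cast
          field_simp
          ring
        rw [this, Real.norm_of_nonneg (by positivity)]
      nlinarith
    · rw [hℓb _ hx, hℓb _ hy, map_add, hg, map_smul, add_sub_add_left_eq_sub, ← smul_sub,
        norm_smul, Real.norm_of_nonneg hε.le, mul_comm]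
      exact (lt_div_iff₀ hε).1 hxy
  have hadd_le : ∀ {x : Fin (r + 2) → ℕ} {i}, (∀ k, x k ≤ 2 * m) → x i < 2 * m →
      ∀ k, (x + Pi.single i 1 : Fin (r + 2) → ℕ) k ≤ 2 * m := by
    intro x i hx hi k
    rcases eq_or_ne k i with rfl | hk
    · simpa using hi
    · simpa [hk] using hx k
  have hadd_dist : ∀ (x : Fin (r + 2) → ℕ) (i),
      dist (gridPoint m x) (gridPoint m (x + Pi.single i 1)) ≤ 1 / m := by
    intro x i
    refine dist_gridPoint_le (v := x) (by simp) fun k => ?_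
    rcases eq_or_ne k i with rfl | hk
    · simp
    · simp [hk]
  have hleft : ∀ {x y : Fin (r + 2) → ℕ}, ‖gridPoint m x‖ = 1 → ‖gridPoint m y‖ = 1 →
      dist (gridPoint m x) (gridPoint m y) ≤ 1 / m →
      (∀ j : Fin r, x j.castSucc.castSucc = m + 1) → x (Fin.last r).castSucc ≤ m →
      y (Fin.last r).castSucc ≤ m → t (gridPoint m x) (gridPoint m y) = 1 := by
    intro x y hx hy hxy hxj hxs hys
    refine hedge hx hy hxj (by simp) ?_
    rw [modelLift_of_le hm hxs, modelLift_of_le hm hys, map_one, Module.End.one_apply]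
    exact hL _ _ hx.le hy.le (hxy.trans_lt hmL)
  have hright : ∀ {x y : Fin (r + 2) → ℕ}, ‖gridPoint m x‖ = 1 → ‖gridPoint m y‖ = 1 →
      dist (gridPoint m x) (gridPoint m y) ≤ 1 / m →
      (∀ j : Fin r, x j.castSucc.castSucc = m + 1) → m < x (Fin.last r).castSucc →
      m < y (Fin.last r).castSucc → t (gridPoint m x) (gridPoint m y) = 1 := by
    intro x y hx hy hxy hxj hxs hys
    refine hedge hx hy hxj (by simp) ?_
    rw [modelLift_of_lt hm hxs, modelLift_of_lt hm hys, map_one, Module.End.one_apply]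
    exact hR _ _ hx.le hy.le (hxy.trans_lt hmR)
  have hzero : ∀ {x : Fin (r + 2) → ℕ} {i}, x i = m → gridPoint m x i = 0 := by
    intro x i hi
    have hm' : (m : ℝ) ≠ 0 := by exact_mod_cast hm.ne'
    simp [gridPoint, hi, hm']
  have hne : Fin.last (r + 1) ≠ (Fin.last r).castSucc := (Fin.castSucc_lt_last _).ne'
  have hcross : ∀ {x y : Fin (r + 2) → ℕ} {g}, ‖gridPoint m x‖ = 1 → ‖gridPoint m y‖ = 1 →
      dist (gridPoint m x) (gridPoint m y) ≤ 1 / m →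
      (∀ j : Fin r, x j.castSucc.castSucc = m + 1) → x (Fin.last r).castSucc = m →
      y (Fin.last r).castSucc = m + 1 → ρ g v = v →
      ρ g (modelLeft a w (gridPoint m x)) = modelRight (ρ h₀) a w q (gridPoint m x) →
      t (gridPoint m x) (gridPoint m y) = g := by
    intro x y g hx hy hxy hxj hxs hys hg hgx
    refine hedge hx hy hxj hg ?_
    rw [modelLift_of_le hm hxs.le, modelLift_of_lt hm (by omega), hgx]
    exact hR _ _ hx.le hy.le (hxy.trans_lt hmR)
  refine hh₀1 (Additive.ofMul.injective (grid_boundary_value_eq_zero hm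
    (s := fun j x => if f v j < f (ℓ (gridPoint m x)) j then 1 else 0)
    (h := fun x y => Additive.ofMul (t (gridPoint m x) (gridPoint m y)))
    (h₀ := Additive.ofMul h₀) ?_ ?_ ?_ ?_ ?_))
  · rintro p ⟨u, hu⟩ hs
    have hp : ∀ k, ‖gridPoint m (p k)‖ ≤ 1 := fun k => norm_gridPoint_le_one hm fun i => by
      have h1 := hu i
      have h2 := h1.2 k
      omega
    have hpd : ∀ k l, dist (gridPoint m (p k)) (gridPoint m (p l)) < μ := fun k l =>
      (dist_gridPoint_le (fun i => (hu i).2 k) fun i => (hu i).2 l).trans_lt hmμ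
    have hpg : ∀ k l, ‖ρ (t (gridPoint m (p k)) (gridPoint m (p l))) (ℓ (gridPoint m (p k))) -
        ℓ (gridPoint m (p l))‖ < η := fun k l => by
      obtain ⟨g, hg⟩ := hμℓ _ _ (hp k) (hp l) (hpd k l)
      exact ht_spec hg
    have hpf : ∀ k, ‖f (ℓ (gridPoint m (p k))) - f v‖ ≤ 2 * B * η := by
      intro k
      refine (pi_norm_le_iff_of_nonneg (by positivity)).2 fun j => ?_
      have hd : ∀ l l', |f (ℓ (gridPoint m (p l))) j - f (ℓ (gridPoint m (p l'))) j| ≤ B * η :=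
        fun l l' => (norm_le_pi_norm
          (f (ℓ (gridPoint m (p l))) - f (ℓ (gridPoint m (p l')))) j).trans
          (hfdiff (hp l) (hp l') (hpd l l'))
      have h1 := hd k j.castSucc.castSucc.castSucc
      have h2 := hd j.castSucc.castSucc.castSucc j.succ.castSucc.castSucc
      have h3 := hs j
      have hBη : 0 < B * η := by positivity
      rw [Pi.sub_apply, Real.norm_eq_abs]
      rw [abs_le] at h1 h2 ⊢
      by_cases h4 : f v j < f (ℓ (gridPoint m (p j.castSucc.castSucc.castSucc))) j <;>
      by_cases h5 : f v j < f (ℓ (gridPoint m (p j.succ.castSucc.castSucc))) j <;>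
      simp only [h4, h5, if_true, if_false, ne_eq, not_true] at h3 <;>
      constructor <;> linarith
    rw [← ofMul_mul, mul_comm]
    congr 1
    symm
    have h01 := hpg (Fin.last r).castSucc.castSucc (Fin.last (r + 1)).castSucc
    have h12 := hpg (Fin.last (r + 1)).castSucc (Fin.last (r + 2))
    have h02 := hpg (Fin.last r).castSucc.castSucc (Fin.last (r + 2))
    have hf0 := hpf (Fin.last r).castSucc.castSucc
    have s01 := hstab (hp _) (hp _) h01
    have s12 := hstab (hp _) (hp _) h12
    refine huniq (ℓ (gridPoint m (p (Fin.last r).castSucc.castSucc))) _ _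
      (hstab (hp _) (hp _) h02) ?_ (hℓ _ (hp _)).2 hf0 ?_
    · rw [map_mul, Module.End.mul_apply, s01, s12]
    · rw [map_mul, Module.End.mul_apply]
      exact htri h01 h12 h02
  · intro x j hx hxb
    have hx1 := norm_gridPoint_eq_one hm hx hxb
    simp only [hfℓ _ hx1, Pi.add_apply, Pi.smul_apply, smul_eq_mul, lt_add_iff_pos_right,
      mul_pos_iff_of_pos_left hε, initCoords, gridPoint_pos_iff hm]
  · intro x hx hxj hxt hxs
    have hx1 := norm_gridPoint_eq_one hm hx ⟨_, Or.inl hxt⟩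
    have hy1 := norm_gridPoint_eq_one hm (hadd_le hx hxs)
      ⟨Fin.last (r + 1), Or.inl (by simp [hxt, hne])⟩
    have hd := hadd_dist x (Fin.last r).castSucc
    rcases lt_trichotomy (x (Fin.last r).castSucc) m with h | h | h
    · rw [if_neg h.ne]
      exact congrArg _ (hleft hx1 hy1 hd hxj h.le (by simpa using h))
    · rw [if_pos h]
      refine congrArg _ (hcross hx1 hy1 hd hxj h (by simpa using h) hh₀ ?_)
      refine (modelRight_eq_map_modelLeft (haρ _ hh₀) (hzero h) ?_).symm
      simp [gridPoint, hxt]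
    · rw [if_neg h.ne']
      exact congrArg _ (hright hx1 hy1 hd hxj h (by simp; omega))
  · intro x hx hxj hxt hxs
    have hx1 := norm_gridPoint_eq_one hm hx ⟨_, Or.inr hxt⟩
    have hy1 := norm_gridPoint_eq_one hm (hadd_le hx hxs)
      ⟨Fin.last (r + 1), Or.inr (by simp [hxt, hne])⟩
    have hd := hadd_dist x (Fin.last r).castSucc
    refine congrArg Additive.ofMul (a₂ := 1) ?_
    rcases lt_trichotomy (x (Fin.last r).castSucc) m with h | h | h
    · exact hleft hx1 hy1 hd hxj h.le (by simpa using h)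
    · refine hcross hx1 hy1 hd hxj h (by simpa using h) (by simp) ?_
      rw [map_one, Module.End.one_apply]
      refine (modelRight_eq_modelLeft (hzero h) ?_).symm
      exact ((gridPoint_pos_iff hm).2 (by omega)).le
    · exact hright hx1 hy1 hd hxj h (by simp; omega)
  · intro x hx hxj hxs hxt
    have hx1 := norm_gridPoint_eq_one hm hx ⟨_, hxs⟩
    have hy1 := norm_gridPoint_eq_one hm (hadd_le hx hxt)
      ⟨(Fin.last r).castSucc, by simpa [hne.symm] using hxs⟩
    have hd := hadd_dist x (Fin.last (r + 1))
    refine congrArg Additive.ofMul (a₂ := 1) ?_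
    rcases hxs with h | h
    · exact hleft hx1 hy1 hd hxj (by omega) (by simp [hne.symm, h])
    · exact hright hx1 hy1 hd hxj (by omega) (by simp [hne.symm, h]; omega)

end GridLift

/-- The orbit space of a finite commutative linear group has no chart of dimension greater than
`r + 2` around the image of a point `v` such that the stabilizer of `v` is nontrivial, fixes a
subspace of dimension `r`, and acts freely on a complement away from the origin. -/
theorem not_isOpenEmbedding_of_free {V Γ Y : Type*} [NormedAddCommGroup V] [NormedSpace ℝ V]
    [FiniteDimensional ℝ V] [CommGroup Γ] [Finite Γ] {ρ : Γ →* (V →ₗ[ℝ] V)} [TopologicalSpace Y]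
    {π : V → Y} (hπc : Continuous π) (hπo : IsOpenMap π) (hπs : Function.Surjective π)
    (hπ : ∀ x y, π x = π y ↔ ∃ g, ρ g x = y) {M r : ℕ} (hrM : r + 2 < M)
    {θ : (Fin M → ℝ) → Y} {v : V} (hv : θ 0 = π v)
    {f : V →ₗ[ℝ] Fin r → ℝ} {a : (Fin r → ℝ) →ₗ[ℝ] V}
    (hfa : ∀ y, f (a y) = y) (hfρ : ∀ g, ρ g v = v → ∀ x, f (ρ g x) = f x)
    (haρ : ∀ g, ρ g v = v → ∀ y, ρ g (a y) = a y)
    (hfree : ∀ g, ρ g v = v → g ≠ 1 → ∀ x, f x = 0 → ρ g x = x → x = 0)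
    {h₀ : Γ} (hh₀ : ρ h₀ v = v) (hh₀1 : h₀ ≠ 1) {w q : V} (hw : w ≠ 0) (hfw : f w = 0)
    (hfq : f q = 0) (hq : q ∉ Submodule.span ℝ {w, ρ h₀ w}) :
    ¬ Topology.IsOpenEmbedding θ := by
  intro hθ
  obtain ⟨C, hC, hρC⟩ := exists_forall_norm_le_of_finite ρ
  obtain ⟨τ, hτ, hfix⟩ := exists_pos_forall_fixes ρ v
  have hfT : f (ρ h₀ w) = 0 := by rw [hfρ _ hh₀, hfw]
  have hcL := continuous_modelLeft a w
  have hcR := continuous_modelRight (ρ h₀) a w q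
  obtain ⟨D, hD⟩ := (isCompact_closedBall (0 : Fin (r + 2) → ℝ) 1).exists_bound_of_continuousOn
    (hcL.norm.add hcR.norm).continuousOn
  obtain ⟨ε, hε, δ, hδ, ℓ, hℓ, hℓb, hclose⟩ := exists_lift_avoiding hπc hπo hπs hπ hC hρC hrM hθ hv
    hτ hfix (b := modelLift (ρ h₀) a w q) (D := D)
    (fun x hx => by
      have h : ‖modelLeft a w x‖ + ‖modelRight (ρ h₀) a w q x‖ ≤ D :=
        (le_abs_self _).trans (hD x (mem_closedBall_zero_iff.2 hx))
      have h1 := norm_nonneg (modelLeft a w x)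
      have h2 := norm_nonneg (modelRight (ρ h₀) a w q x)
      unfold modelLift
      split_ifs <;> linarith)
    (fun ε => by
      have h : (fun x => π (v + ε • modelLift (ρ h₀) a w q x)) = fun x =>
          if x (Fin.last r).castSucc ≤ 0 then π (v + ε • modelLeft a w x)
          else π (v + ε • modelRight (ρ h₀) a w q x) := by
        funext x
        unfold modelLift
        split_ifs <;> rfl
      rw [h]
      refine Continuous.if_le (by fun_prop) (by fun_prop) (by fun_prop) continuous_const ?_
      intro x hx
      rcases le_total 0 (x (Fin.last (r + 1))) with ht | ht
      · rw [modelRight_eq_modelLeft hx ht]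
      · rw [modelRight_eq_map_modelLeft (haρ h₀ hh₀) hx ht, hπ]
        exact ⟨h₀, by rw [map_add, map_smul, hh₀]⟩)
    (fun x => modelLift_eq_zero hfa hfw hfT hfq hw hq)
  exact false_of_lift hfa hfρ haρ hfree hh₀ hh₀1 hfw hfq hC hρC hτ hfix hε hδ hℓ hℓb hclose

/-- Linear coordinates of the projection onto the invariants given by averaging. -/
theorem Representation.exists_coord_invariants {V G : Type*} [AddCommGroup V] [Module ℝ V]
    [FiniteDimensional ℝ V] [Group G] [Finite G] (σ : Representation ℝ G V) :
    ∃ (f : V →ₗ[ℝ] Fin (Module.finrank ℝ σ.invariants) → ℝ)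
      (a : (Fin (Module.finrank ℝ σ.invariants) → ℝ) →ₗ[ℝ] V),
      (∀ y, f (a y) = y) ∧ (∀ g x, f (σ g x) = f x) ∧ (∀ g y, σ g (a y) = a y) ∧
      ∀ x ∈ σ.invariants, f x = 0 → x = 0 := by
  have := Fintype.ofFinite G
  have : Invertible (Fintype.card G : ℝ) := invertibleOfNonzero (by positivity)
  let P : V →ₗ[ℝ] σ.invariants := σ.averageMap.codRestrict _ σ.averageMap_invariant
  let b := (Module.finBasis ℝ σ.invariants).equivFun
  have hP : ∀ x : σ.invariants, P x = x := fun x => Subtype.ext (σ.averageMap_id x x.2)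
  refine ⟨b ∘ₗ P, σ.invariants.subtype ∘ₗ b.symm, fun y => ?_, fun g x => ?_,
    fun g y => (b.symm y).2 g, fun x hx hfx => ?_⟩
  · simp [hP]
  · have : σ.averageMap (σ g x) = σ.averageMap x := by
      rw [← σ.asAlgebraHom_of g, Representation.averageMap, ← Module.End.mul_apply, ← map_mul,
        MonoidAlgebra.of_apply, GroupAlgebra.mul_average_right]
    have : P (σ g x) = P x := Subtype.ext this
    simp [this]
  · have h : P x = 0 := by simpa using hfx
    have := hP ⟨x, hx⟩
    rw [h] at this
    exact congrArg Subtype.val this.symm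

/-- A point with minimal nontrivial stabilizer. -/
theorem exists_minimal_nontrivial_stabilizer {V Γ : Type*} [AddCommGroup V] [Module ℝ V]
    [Group Γ] [Finite Γ] [Nontrivial Γ] (ρ : Γ →* (V →ₗ[ℝ] V)) :
    ∃ v, (∃ g ≠ 1, ρ g v = v) ∧ ∀ y, (∀ g, ρ g y = y → ρ g v = v) → (∃ g ≠ 1, ρ g y = y) →
      ∀ g, ρ g v = v → ρ g y = y := by
  obtain ⟨g₀, hg₀⟩ := exists_ne (1 : Γ)
  obtain ⟨v, hv, hmin⟩ := (measure fun v => {g | ρ g v = v}.ncard).wf.has_min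
    {v | ∃ g ≠ 1, ρ g v = v} ⟨0, g₀, hg₀, map_zero _⟩
  refine ⟨v, hv, fun y hy hg g => ?_⟩
  have h : {g | ρ g y = y} = {g | ρ g v = v} :=
    Set.eq_of_subset_of_ncard_le hy (not_lt.1 (hmin y hg)) (Set.toFinite _)
  exact fun h' => h.ge h'

/-- The orbit space of a nontrivial finite commutative linear group, all of whose nontrivial
elements have fixed subspaces of real codimension at least three, has no Euclidean open
neighborhood of the image of the origin. -/
theorem isEmpty_homeomorph_of_isQuotientMap {V Γ Y : Type*} [NormedAddCommGroup V]
    [NormedSpace ℝ V] [FiniteDimensional ℝ V] [CommGroup Γ] [Finite Γ] [Nontrivial Γ]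
    {ρ : Γ →* (V →ₗ[ℝ] V)} {M : ℕ} (hM : Module.finrank ℝ V = M)
    (hcodim : ∀ g ≠ 1, Module.finrank ℝ (LinearMap.ker (ρ g - LinearMap.id)) + 3 ≤ M)
    [TopologicalSpace Y] {π : V → Y} (hπq : Topology.IsQuotientMap π)
    (hπ : ∀ x y, π x = π y ↔ ∃ g, ρ g x = y) {U : Set Y} (hU : IsOpen U) (h0 : π 0 ∈ U) :
    IsEmpty (U ≃ₜ (Fin M → ℝ)) := by
  refine ⟨fun e => ?_⟩
  have hπo : IsOpenMap π := by
    intro s hs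
    rw [← hπq.isOpen_preimage]
    have : π ⁻¹' (π '' s) = ⋃ g, ρ g ⁻¹' s := by
      ext x
      simp only [Set.mem_preimage, Set.mem_image, Set.mem_iUnion]
      constructor
      · rintro ⟨y, hy, hyx⟩
        obtain ⟨g, rfl⟩ := (hπ _ _).1 hyx.symm
        exact ⟨g, hy⟩
      · rintro ⟨g, hg⟩
        exact ⟨_, hg, ((hπ _ _).2 ⟨g, rfl⟩).symm⟩
    rw [this]
    exact isOpen_iUnion fun g => hs.preimage (LinearMap.continuous_of_finiteDimensional _)
  obtain ⟨v₀, ⟨h₀, hh₀1, hh₀⟩, hmin⟩ := exists_minimal_nontrivial_stabilizer ρ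
  obtain ⟨v, hvU, hvstab⟩ : ∃ v, π v ∈ U ∧ ∀ g, ρ g v = v ↔ ρ g v₀ = v₀ := by
    have hcont : Continuous fun c : ℝ => π (c • v₀) := hπq.continuous.comp (by fun_prop)
    have h1 : ∀ᶠ c : ℝ in nhds 0, π (c • v₀) ∈ U :=
      hcont.continuousAt.eventually_mem (hU.mem_nhds (by simpa using h0))
    obtain ⟨c, hc, hc0⟩ := ((h1.filter_mono nhdsWithin_le_nhds).and
      (self_mem_nhdsWithin : {0}ᶜ ∈ nhdsWithin (0 : ℝ) {0}ᶜ)).exists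
    exact ⟨c • v₀, hc, fun g => by rw [map_smul, smul_right_inj hc0]⟩
  let H : Subgroup Γ :=
    { carrier := {g | ρ g v = v}
      mul_mem' := fun {g g'} hg hg' => by
        change ρ (g * g') v = v
        rw [map_mul, Module.End.mul_apply, hg', hg]
      one_mem' := by simp
      inv_mem' := fun {g} hg => by
        change ρ g⁻¹ v = v
        nth_rw 1 [← (hg : ρ g v = v)]
        rw [← Module.End.mul_apply, ← map_mul, inv_mul_cancel, map_one, Module.End.one_apply] }
  let σ : Representation ℝ H V := ρ.comp H.subtype
  obtain ⟨f, a, hfa, hfσ, haσ, hinv⟩ := σ.exists_coord_invariants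
  have hr : Module.finrank ℝ σ.invariants + 3 ≤ M := by
    refine le_trans (Nat.add_le_add_right (Submodule.finrank_mono fun x hx => ?_) 3)
      (hcodim h₀ hh₀1)
    rw [LinearMap.mem_ker, LinearMap.sub_apply, LinearMap.id_apply, sub_eq_zero]
    exact hx ⟨h₀, (hvstab _).2 hh₀⟩
  have hker : 3 ≤ Module.finrank ℝ (LinearMap.ker f) := by
    have h1 := f.finrank_range_add_finrank_ker
    have h2 := (LinearMap.range f).finrank_le
    rw [Module.finrank_fin_fun] at h2
    omega
  obtain ⟨w, hfw, hw⟩ := (LinearMap.ker f).exists_mem_ne_zero_of_ne_bot (by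
    intro h
    rw [h, finrank_bot] at hker
    omega)
  obtain ⟨q, hfq, hq⟩ : ∃ q ∈ LinearMap.ker f, q ∉ Submodule.span ℝ {w, ρ h₀ w} := by
    by_contra! h
    have h1 := Submodule.finrank_mono (show LinearMap.ker f ≤ _ from h)
    have h2 : Module.finrank ℝ (Submodule.span ℝ {w, ρ h₀ w}) ≤ 2 := by
      classical
      have := finrank_span_finset_le_card (R := ℝ) {w, ρ h₀ w}
      rw [Finset.coe_pair] at this
      exact this.trans Finset.card_le_two
    omega
  refine not_isOpenEmbedding_of_free hπq.continuous hπo hπq.surjective hπ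
    (M := M) (θ := fun y => (e.symm (y + e ⟨π v, hvU⟩) : Y)) (v := v) hr (by simp) hfa
    (fun g hg => hfσ ⟨g, hg⟩) (fun g hg => haσ ⟨g, hg⟩) ?_ ((hvstab _).2 hh₀) hh₀1 hw hfw hfq hq
    (hU.isOpenEmbedding_subtypeVal.comp
      (e.symm.isOpenEmbedding.comp (Homeomorph.addRight _).isOpenEmbedding))
  intro g hg hg1 x hfx hgx
  obtain ⟨τ, hτ, hfix⟩ := exists_pos_forall_fixes ρ v
  obtain ⟨s, hs, hs0⟩ : ∃ s : ℝ, ‖s • x‖ < τ ∧ s ≠ 0 := by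
    have hcont : Continuous fun s : ℝ => ‖s • x‖ := by fun_prop
    have h1 : ∀ᶠ s : ℝ in nhds 0, ‖s • x‖ < τ :=
      hcont.continuousAt.eventually_lt continuousAt_const (by simpa using hτ)
    exact ((h1.filter_mono nhdsWithin_le_nhds).and
      (self_mem_nhdsWithin : {0}ᶜ ∈ nhdsWithin (0 : ℝ) {0}ᶜ)).exists
  have hfixy := hmin (v + s • x) (fun k hk => (hvstab k).1 (hfix k (v + s • x) (v + s • x)
    (by simpa using hs) (by simpa using hs) (by simpa [hk] using hτ)))
    ⟨g, hg1, by rw [map_add, map_smul, hg, hgx]⟩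
  refine hinv x (fun k => ?_) hfx
  have h1 := hfixy k ((hvstab _).1 k.2)
  have h2 : ρ k v = v := k.2
  rw [map_add, map_smul, h2, add_right_inj, smul_right_inj hs0] at h1
  exact h1

/-- If a nontrivial finite abelian group `Γ` acts faithfully and ℂ-linearly on `V = ℂⁿ`
(`n ≥ 1`) with every nontrivial fixed-point subspace of complex codimension at least `2`
(no pseudoreflections), then no open neighborhood of `[0]` in the orbit space `V/Γ`
is homeomorphic to `ℝ^{2n}`; i.e. `V/Γ` has a topological singularity at `[0]`. -/
theorem orbit_space_not_manifold_at_zero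
    (n : ℕ) (hn : 1 ≤ n) (Γ : Type) [CommGroup Γ] [Finite Γ] [Nontrivial Γ]
    (ρ : Γ →* ((Fin n → ℂ) ≃ₗ[ℂ] (Fin n → ℂ)))
    (hfaith : Function.Injective ρ)
    (hcodim : ∀ γ : Γ, γ ≠ 1 →
      Module.finrank ℂ
        (LinearMap.ker ((ρ γ : (Fin n → ℂ) →ₗ[ℂ] (Fin n → ℂ)) - LinearMap.id)) + 2 ≤ n) :
    ¬ ∃ U : Set (Quotient (actionSetoid (endHomOfRep ρ))),
        IsOpen U ∧ Quotient.mk (actionSetoid (endHomOfRep ρ)) 0 ∈ U ∧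
        Nonempty (U ≃ₜ (Fin (2 * n) → ℝ)) := by
  rintro ⟨U, hU, h0, ⟨e⟩⟩
  let ρR : Γ →* ((Fin n → ℂ) →ₗ[ℝ] (Fin n → ℂ)) :=
    { toFun := fun g => (ρ g : (Fin n → ℂ) →ₗ[ℂ] (Fin n → ℂ)).restrictScalars ℝ
      map_one' := LinearMap.ext fun x => by simp
      map_mul' := fun g g' => LinearMap.ext fun x => by simp }
  refine (isEmpty_homeomorph_of_isQuotientMap (ρ := ρR)
    (π := Quotient.mk (actionSetoid (endHomOfRep ρ))) ?_ ?_ isQuotientMap_quot_mk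
    (fun x y => Quotient.eq (r := actionSetoid (endHomOfRep ρ))) hU h0).false e
  · rw [finrank_real_of_complex, Module.finrank_fin_fun]
  · intro g hg
    have h1 : LinearMap.ker (ρR g - LinearMap.id) = (LinearMap.ker
        ((ρ g : (Fin n → ℂ) →ₗ[ℂ] (Fin n → ℂ)) - LinearMap.id)).restrictScalars ℝ := rfl
    have h2 := hcodim g hg
    have h3 := finrank_real_of_complex (LinearMap.ker
        ((ρ g : (Fin n → ℂ) →ₗ[ℂ] (Fin n → ℂ)) - LinearMap.id))
    have h4 : Module.finrank ℝ ((LinearMap.ker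
        ((ρ g : (Fin n → ℂ) →ₗ[ℂ] (Fin n → ℂ)) - LinearMap.id)).restrictScalars ℝ) =
        Module.finrank ℝ (LinearMap.ker
        ((ρ g : (Fin n → ℂ) →ₗ[ℂ] (Fin n → ℂ)) - LinearMap.id)) := rfl
    rw [h1, h4, h3]
    omega
end

section
/- Let r ≥ 2, let V be a finite-dimensional complex representation of the free group F_r, and let ξ : V → V be a ℂ-linear automorphism of finite order commuting with the action of every element of F_r. Then dim_ℂ H¹(F_r; V) − dim_ℂ H¹(F_r; V)^ξ ≥ (r − 1)·(dim_ℂ V − dim_ℂ V^ξ), where V^ξ = {v ∈ V : ξ(v) = v} and H¹(F_r; V)^ξ is the fixed subspace of the induced action of ξ on H¹(F_r; V). -/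
/-- The 1-cocycles `Z¹(G;V) = {f : G → V | f(gh) = f(g) + g·f(h)}` of a representation. -/
def oneCocycles' {k G V : Type*} [CommRing k] [Group G] [AddCommGroup V] [Module k V]
    (ρ : Representation k G V) : Submodule k (G → V) where
  carrier := {f | ∀ g h : G, f (g * h) = f g + ρ g (f h)}
  add_mem' := by
    intro a b ha hb g h
    simp only [Pi.add_apply, ha g h, hb g h, map_add]
    abel
  zero_mem' := by
    intro g h
    simp
  smul_mem' := by
    intro c a ha g h
    simp only [Pi.smul_apply, ha g h, map_smul, smul_add]

/-- The coboundary map `V → (G → V)`, `v ↦ (g ↦ g·v − v)`; its range is `B¹(G;V)`. -/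
def dZero' {k G V : Type*} [CommRing k] [Group G] [AddCommGroup V] [Module k V]
    (ρ : Representation k G V) : V →ₗ[k] (G → V) where
  toFun v := fun g => ρ g v - v
  map_add' := by
    intro v w
    funext g
    simp only [map_add, Pi.add_apply]
    abel
  map_smul' := by
    intro c v
    funext g
    simp [map_smul, smul_sub]

/-- First group cohomology `H¹(G;V) = Z¹(G;V)/B¹(G;V)`. -/
abbrev H1' {k G V : Type*} [CommRing k] [Group G] [AddCommGroup V] [Module k V]
    (ρ : Representation k G V) :=
  ↥(oneCocycles' ρ) ⧸ (LinearMap.range (dZero' ρ)).comap (oneCocycles' ρ).subtype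

section Cocycles

variable {k G V : Type*} [CommRing k] [Group G] [AddCommGroup V] [Module k V]

theorem oneCocycles'_map_one {ρ : Representation k G V} (f : oneCocycles' ρ) : f.1 1 = 0 := by
  simpa using f.2 1 1

theorem oneCocycles'_map_inv {ρ : Representation k G V} (f : oneCocycles' ρ) (g : G) :
    f.1 g⁻¹ = -ρ g⁻¹ (f.1 g) := by
  have h := f.2 g⁻¹ g
  rw [inv_mul_cancel, oneCocycles'_map_one] at h
  exact eq_neg_of_add_eq_zero_left h.symm

end Cocycles

section FreeGroup

variable {k α V : Type*} [CommRing k] [AddCommGroup V] [Module k V]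

/-- Evaluation of cocycles of a free group on the generators. -/
def oneCocyclesEvalGenerators (ρ : Representation k (FreeGroup α) V) :
    oneCocycles' ρ →ₗ[k] (α → V) where
  toFun f i := f.1 (FreeGroup.of i)
  map_add' _ _ := rfl
  map_smul' _ _ := rfl

theorem oneCocyclesEvalGenerators_injective (ρ : Representation k (FreeGroup α) V) :
    Function.Injective (oneCocyclesEvalGenerators ρ) := by
  refine (injective_iff_map_eq_zero _).2 fun f hf => Subtype.ext (funext fun g => ?_)
  have hof (i : α) : f.1 (FreeGroup.of i) = 0 := congrFun hf i
  change f.1 g = 0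
  induction g using FreeGroup.induction_on with
  | C1 => exact oneCocycles'_map_one f
  | of i => exact hof i
  | inv_of i _ =>
    have h := oneCocycles'_map_inv f (FreeGroup.of i)
    rw [hof i, map_zero, neg_zero] at h
    exact h
  | mul x y hx hy => rw [f.2 x y, hx, hy, map_zero, add_zero]

/-- The affine permutation `v ↦ ρ g v + w`. -/
def Representation.affinePerm {G : Type*} [Group G] (ρ : Representation k G V) (g : G) (w : V) :
    Equiv.Perm V where
  toFun v := ρ g v + w
  invFun v := ρ g⁻¹ (v - w)
  left_inv v := by simp
  right_inv v := by simp

/-- The affine action of a free group whose translation parts on the generators are `s`. -/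
def Representation.affineAction (ρ : Representation k (FreeGroup α) V) (s : α → V) :
    FreeGroup α →* Equiv.Perm V :=
  FreeGroup.lift (fun i => ρ.affinePerm (FreeGroup.of i) (s i))

theorem Representation.affineAction_apply (ρ : Representation k (FreeGroup α) V) (s : α → V)
    (g : FreeGroup α) (v : V) :
    ρ.affineAction s g v =
      ρ g v + ρ.affineAction s g 0 := by
  induction g using FreeGroup.induction_on generalizing v with
  | C1 => simp
  | of i => simp [Representation.affineAction, Representation.affinePerm]
  | inv_of i _ =>
    rw [map_inv, Representation.affineAction, FreeGroup.lift_apply_of]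
    change ρ (FreeGroup.of i)⁻¹ (v - s i) =
      ρ (FreeGroup.of i)⁻¹ v + ρ (FreeGroup.of i)⁻¹ (0 - s i)
    rw [← map_add]
    congr 1
    abel
  | mul x y hx hy =>
    rw [map_mul, Equiv.Perm.mul_apply, Equiv.Perm.mul_apply, hx, hy v,
      hx (ρ.affineAction s y 0), map_mul, Module.End.mul_apply, map_add, add_assoc]

theorem oneCocyclesEvalGenerators_surjective (ρ : Representation k (FreeGroup α) V) :
    Function.Surjective (oneCocyclesEvalGenerators ρ) := by
  intro s
  refine ⟨⟨fun g => ρ.affineAction s g 0,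
    fun g h => ?_⟩, funext fun i => ?_⟩
  · beta_reduce
    rw [map_mul, Equiv.Perm.mul_apply, ρ.affineAction_apply, add_comm]
  · simp [oneCocyclesEvalGenerators, Representation.affineAction,
      Representation.affinePerm]

/-- A cocycle of a free group is determined by arbitrary values on the generators. -/
noncomputable def oneCocyclesEquivGenerators (ρ : Representation k (FreeGroup α) V) :
    oneCocycles' ρ ≃ₗ[k] (α → V) :=
  LinearEquiv.ofBijective (oneCocyclesEvalGenerators ρ)
    ⟨oneCocyclesEvalGenerators_injective ρ, oneCocyclesEvalGenerators_surjective ρ⟩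

theorem oneCocyclesEquivGenerators_symm_of (ρ : Representation k (FreeGroup α) V)
    (s : α → V) (i : α) :
    ((oneCocyclesEquivGenerators ρ).symm s).1 (FreeGroup.of i) = s i :=
  congrFun ((oneCocyclesEquivGenerators ρ).apply_symm_apply s) i

end FreeGroup

section FiniteOrder

variable {k V : Type*} [Field k] [CharZero k] [AddCommGroup V] [Module k V]

theorem disjoint_range_ker_sub_id_of_isOfFinOrder {ξ : V ≃ₗ[k] V} (hξ : IsOfFinOrder ξ) :
    Disjoint (LinearMap.range ((ξ : V →ₗ[k] V) - LinearMap.id))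
      (LinearMap.ker ((ξ : V →ₗ[k] V) - LinearMap.id)) := by
  rw [Submodule.disjoint_def]
  rintro _ ⟨v, rfl⟩ hu
  set u : V := ((ξ : V →ₗ[k] V) - LinearMap.id : V →ₗ[k] V) v with hu_def
  have hv : ξ v = v + u := by simp [hu_def]
  have hfix : ξ u = u := sub_eq_zero.1 hu
  have hpow (m : ℕ) : (ξ ^ m) v = v + m • u := by
    induction m with
    | zero => simp
    | succ m ih =>
      rw [pow_succ', LinearEquiv.mul_apply, ih, map_add, map_nsmul, hv, hfix, succ_nsmul']
      abel
  obtain ⟨n, hn, hn1⟩ := isOfFinOrder_iff_pow_eq_one.1 hξ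
  have h := hpow n
  rw [hn1, LinearEquiv.coe_one, id_eq, left_eq_add, ← Nat.cast_smul_eq_nsmul k] at h
  exact (smul_eq_zero.1 h).resolve_left (Nat.cast_ne_zero.2 hn.ne')

theorem range_sup_ker_sub_id_of_isOfFinOrder [FiniteDimensional k V] {ξ : V ≃ₗ[k] V}
    (hξ : IsOfFinOrder ξ) :
    LinearMap.range ((ξ : V →ₗ[k] V) - LinearMap.id) ⊔
      LinearMap.ker ((ξ : V →ₗ[k] V) - LinearMap.id) = ⊤ :=
  Submodule.eq_top_of_disjoint _ _ (LinearMap.finrank_range_add_finrank_ker _).ge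
    (disjoint_range_ker_sub_id_of_isOfFinOrder hξ)

end FiniteOrder

/-- **Proposition 5.2**: for `r ≥ 2` and a finite-order automorphism `ξ` of `V` commuting
with a representation of `F_r`, the induced action `Φ` of `ξ` on `H¹(F_r;V)` satisfies
`dim H¹(F_r;V) − dim H¹(F_r;V)^ξ ≥ (r−1)·(dim V − dim V^ξ)`. -/
theorem finrank_H1_sub_fixed_ge (r : ℕ) (hr : 2 ≤ r)
    (V : Type) [AddCommGroup V] [Module ℂ V] [FiniteDimensional ℂ V]
    (ρ : Representation ℂ (FreeGroup (Fin r)) V)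
    (ξ : V ≃ₗ[ℂ] V) (hord : IsOfFinOrder ξ)
    (hcomm : ∀ (g : FreeGroup (Fin r)) (v : V), ξ (ρ g v) = ρ g (ξ v)) :
    ∀ Φ : H1' ρ →ₗ[ℂ] H1' ρ,
      (∀ f g : ↥(oneCocycles' ρ),
          ((fun x => ξ (f.1 x)) - g.1) ∈ LinearMap.range (dZero' ρ) →
          Φ (Submodule.Quotient.mk f) = Submodule.Quotient.mk g) →
      Module.finrank ℂ (H1' ρ) - Module.finrank ℂ (LinearMap.ker (Φ - LinearMap.id)) ≥
        (r - 1) * (Module.finrank ℂ V -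
          Module.finrank ℂ (LinearMap.ker ((ξ : V →ₗ[ℂ] V) - LinearMap.id))) := by
  intro Φ hΦ
  set N : V →ₗ[ℂ] V := (ξ : V →ₗ[ℂ] V) - LinearMap.id
  have hN_apply (v : V) : N v = ξ v - v := rfl
  have hN_comm (g : FreeGroup (Fin r)) (v : V) : N (ρ g v) = ρ g (N v) := by
    rw [hN_apply, hN_apply, hcomm, map_sub]
  let W := LinearMap.range N
  have hW (g : FreeGroup (Fin r)) {w : V} (hw : w ∈ W) : ρ g w ∈ W := by
    obtain ⟨v, rfl⟩ := hw
    exact ⟨ρ g v, hN_comm g v⟩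
  let e := oneCocyclesEquivGenerators ρ
  have : FiniteDimensional ℂ (oneCocycles' ρ) := e.symm.finiteDimensional
  let T : (Fin r → W) →ₗ[ℂ] H1' ρ :=
    Submodule.mkQ _ ∘ₗ e.symm.toLinearMap ∘ₗ W.subtype.compLeft (Fin r)
  let D : W →ₗ[ℂ] (Fin r → W) := LinearMap.pi fun i =>
    (ρ (FreeGroup.of i) - LinearMap.id).restrict fun w hw => W.sub_mem (hW _ hw) hw
  have hT_range : LinearMap.range T ≤ LinearMap.range (Φ - LinearMap.id) := by
    rintro _ ⟨w, rfl⟩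
    choose v hv using fun i => (w i).2
    let f := e.symm v
    let g : oneCocycles' ρ := ⟨fun x => ξ (f.1 x), fun x y => by
      beta_reduce
      rw [f.2 x y, map_add, hcomm]⟩
    have hfg : Φ (Submodule.Quotient.mk f) = Submodule.Quotient.mk g :=
      hΦ f g ⟨0, by simp [g]⟩
    refine ⟨Submodule.Quotient.mk f, ?_⟩
    rw [LinearMap.sub_apply, hfg, LinearMap.id_apply, ← Submodule.Quotient.mk_sub]
    change _ = Submodule.Quotient.mk (e.symm (fun i => (w i : V)))
    congr 1
    rw [LinearEquiv.eq_symm_apply]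
    funext i
    change ξ (f.1 (FreeGroup.of i)) - f.1 (FreeGroup.of i) = w i
    rw [oneCocyclesEquivGenerators_symm_of, ← hv i, hN_apply]
  have hT_ker : LinearMap.ker T ≤ LinearMap.range D := by
    intro w hw
    obtain ⟨v, hv⟩ := (Submodule.Quotient.mk_eq_zero _).1 (LinearMap.mem_ker.1 hw)
    have hvw (i : Fin r) : ρ (FreeGroup.of i) v - v = w i :=
      (congrFun hv (FreeGroup.of i)).trans (oneCocyclesEquivGenerators_symm_of ρ _ i)
    obtain ⟨a, ha, u, hu, rfl⟩ := Submodule.mem_sup.1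
      ((range_sup_ker_sub_id_of_isOfFinOrder hord).ge (Submodule.mem_top (x := v)))
    refine ⟨⟨a, ha⟩, funext fun i => Subtype.ext ?_⟩
    change ρ (FreeGroup.of i) a - a = w i
    have hsplit : (w i : V) - (ρ (FreeGroup.of i) a - a) = ρ (FreeGroup.of i) u - u := by
      rw [← hvw i, map_add]
      abel
    refine (sub_eq_zero.1 (Submodule.disjoint_def.1
      (disjoint_range_ker_sub_id_of_isOfFinOrder hord) _
      (W.sub_mem (w i).2 (W.sub_mem (hW _ ha) ha)) ?_)).symm
    rw [hsplit, LinearMap.mem_ker, map_sub]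
    change N _ - N u = 0
    rw [hN_comm, show N u = 0 from hu, map_zero, sub_zero]
  have hV := LinearMap.finrank_range_add_finrank_ker N
  have hH := LinearMap.finrank_range_add_finrank_ker (Φ - LinearMap.id)
  have hT := LinearMap.finrank_range_add_finrank_ker T
  rw [Module.finrank_pi_fintype, Finset.sum_const, Finset.card_univ, Fintype.card_fin,
    smul_eq_mul] at hT
  have hle := Submodule.finrank_mono hT_range
  have hker := (Submodule.finrank_mono hT_ker).trans (LinearMap.finrank_range_le D)
  rw [← hV, ← hH, Nat.add_sub_cancel, Nat.add_sub_cancel, Nat.sub_mul, one_mul]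
  change r * Module.finrank ℂ W - Module.finrank ℂ W ≤ _
  omega
end
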